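/- arXiv:1008.0810 — 10 statements merged into one kernel-verified Lean document; each statement's English description precedes it below -/
import Mathlib

section
/- Miquel's pivot theorem: Let A, B, C be three non-collinear points in the plane (identified with ℂ). Let P be a point on line AB with P ≠ A and P ≠ B, let Q be a point on line BC with Q ≠ B and Q ≠ C, and let R be a point on line CA with R ≠ C and R ≠ A. Then the circumcircle of A, R, P, the circumcircle of B, P, Q, and the circumcircle of C, Q, R have a common point S. -/
/-- Two points of the plane at squared distance zero coincide. -/
lemma eq_of_sq_add_sq_eq_zero {z w : ℂ}
    (h : (z.re - w.re) ^ 2 + (z.im - w.im) ^ 2 = 0) : z = w := by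
  apply Complex.ext <;> nlinarith [sq_nonneg (z.re - w.re), sq_nonneg (z.im - w.im)]

/-- If three points of the plane span zero signed area, they are collinear. -/
lemma collinear_of_cross_eq_zero {A B C : ℂ}
    (h : (B.re - A.re) * (C.im - A.im) - (B.im - A.im) * (C.re - A.re) = 0) :
    Collinear ℝ ({A, B, C} : Set ℂ) := by
  by_cases hAB : A = B
  · subst hAB
    simpa using collinear_pair ℝ A C
  have hN : (B.re - A.re) ^ 2 + (B.im - A.im) ^ 2 ≠ 0 := fun h0 ↦
    hAB (eq_of_sq_add_sq_eq_zero h0).symm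
  rw [collinear_iff_of_mem (p₀ := A) (by simp)]
  refine ⟨B - A, ?_⟩
  simp only [Set.mem_insert_iff, Set.mem_singleton_iff, forall_eq_or_imp, forall_eq]
  refine ⟨⟨0, by simp⟩, ⟨1, by simp⟩,
    ⟨((C.re - A.re) * (B.re - A.re) + (C.im - A.im) * (B.im - A.im)) /
      ((B.re - A.re) ^ 2 + (B.im - A.im) ^ 2), ?_⟩⟩
  apply Complex.ext
  · simp only [vadd_eq_add, Complex.add_re, Complex.real_smul, Complex.re_ofReal_mul,
      Complex.sub_re]
    field_simp
    linear_combination (-(B.im - A.im)) * h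
  · simp only [vadd_eq_add, Complex.add_im, Complex.real_smul, Complex.im_ofReal_mul,
      Complex.sub_im]
    field_simp
    linear_combination (B.re - A.re) * h

/-- A point collinear with two distinct points is an affine combination of them. -/
lemma exists_coords_of_collinear {A B P : ℂ} (hAB : A ≠ B)
    (h : Collinear ℝ ({A, B, P} : Set ℂ)) :
    ∃ t : ℝ, P.re = A.re + t * (B.re - A.re) ∧ P.im = A.im + t * (B.im - A.im) := by
  have hm := h.mem_affineSpan_of_mem_of_ne (p₁ := A) (p₂ := B) (p₃ := P)
    (by simp) (by simp) (by simp) hAB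
  obtain ⟨t, rfl⟩ := mem_affineSpan_pair_iff_exists_lineMap_eq.1 hm
  refine ⟨t, ?_, ?_⟩ <;> simp [AffineMap.lineMap_apply] <;> ring

/-- Two points of a circle in the plane are at the same squared distance from its center. -/
lemma normSq_sub_center_eq {s : EuclideanGeometry.Sphere ℂ} {X Y : ℂ} (hX : X ∈ s)
    (hY : Y ∈ s) :
    (X.re - s.center.re) ^ 2 + (X.im - s.center.im) ^ 2 =
      (Y.re - s.center.re) ^ 2 + (Y.im - s.center.im) ^ 2 := by
  have h : dist X s.center = dist Y s.center := by
    rw [EuclideanGeometry.mem_sphere.1 hX, EuclideanGeometry.mem_sphere.1 hY]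
  rw [Complex.dist_eq_re_im, Complex.dist_eq_re_im,
    Real.sqrt_inj (by positivity) (by positivity)] at h
  exact h

/-- A point as far from the center as a point of a circle lies on that circle. -/
lemma mem_sphere_of_normSq_eq {s : EuclideanGeometry.Sphere ℂ} {X Y : ℂ} (hY : Y ∈ s)
    (h : (X.re - s.center.re) ^ 2 + (X.im - s.center.im) ^ 2 =
      (Y.re - s.center.re) ^ 2 + (Y.im - s.center.im) ^ 2) : X ∈ s := by
  rw [EuclideanGeometry.mem_sphere, ← EuclideanGeometry.mem_sphere.1 hY,
    Complex.dist_eq_re_im, Complex.dist_eq_re_im, h]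

/-- The center of a circle through the origin, `s • b` and `t • c`, by Cramer's rule. -/
lemma center_coords {b₁ b₂ c₁ c₂ s t x y : ℝ} (hs : s ≠ 0) (ht : t ≠ 0)
    (h₁ : (s * b₁ - x) ^ 2 + (s * b₂ - y) ^ 2 = x ^ 2 + y ^ 2)
    (h₂ : (t * c₁ - x) ^ 2 + (t * c₂ - y) ^ 2 = x ^ 2 + y ^ 2) :
    2 * (b₁ * c₂ - b₂ * c₁) * x =
        s * (b₁ ^ 2 + b₂ ^ 2) * c₂ - t * (c₁ ^ 2 + c₂ ^ 2) * b₂ ∧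
      2 * (b₁ * c₂ - b₂ * c₁) * y =
        t * (c₁ ^ 2 + c₂ ^ 2) * b₁ - s * (b₁ ^ 2 + b₂ ^ 2) * c₁ := by
  have e₁ : 2 * (x * b₁ + y * b₂) = s * (b₁ ^ 2 + b₂ ^ 2) :=
    mul_left_cancel₀ hs (by linear_combination -h₁)
  have e₂ : 2 * (x * c₁ + y * c₂) = t * (c₁ ^ 2 + c₂ ^ 2) :=
    mul_left_cancel₀ ht (by linear_combination -h₂)
  constructor
  · linear_combination c₂ * e₁ - b₂ * e₂
  · linear_combination b₁ * e₂ - c₁ * e₁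

/-- The cross product of two vectors given by their coordinates in the basis obtained by
rotating `c` and `b` through a right angle. -/
lemma cross_eq_of_rotated_coords {b₁ b₂ c₁ c₂ p q p' q' x y x' y' : ℝ}
    (hD : b₁ * c₂ - b₂ * c₁ ≠ 0)
    (hx : 2 * (b₁ * c₂ - b₂ * c₁) * x = p * c₂ + q * b₂)
    (hy : 2 * (b₁ * c₂ - b₂ * c₁) * y = -(p * c₁ + q * b₁))
    (hx' : 2 * (b₁ * c₂ - b₂ * c₁) * x' = p' * c₂ + q' * b₂)
    (hy' : 2 * (b₁ * c₂ - b₂ * c₁) * y' = -(p' * c₁ + q' * b₁)) :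
    4 * (b₁ * c₂ - b₂ * c₁) * (y * x' - x * y') = p * q' - q * p' := by
  apply mul_left_cancel₀ hD
  calc
    _ = (2 * (b₁ * c₂ - b₂ * c₁) * y) * (2 * (b₁ * c₂ - b₂ * c₁) * x') -
        (2 * (b₁ * c₂ - b₂ * c₁) * x) * (2 * (b₁ * c₂ - b₂ * c₁) * y') := by ring
    _ = (b₁ * c₂ - b₂ * c₁) * (p * q' - q * p') := by rw [hx, hy, hx', hy']; ring

/-- The power of `P` with respect to the circle `CQR`, where `A` is the origin, `b = B - A`,
`c = C - A`, and `(x, y)` is the center of the circle. -/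
lemma power_eq {b₁ b₂ c₁ c₂ t u v x y : ℝ} (hu' : 1 - u ≠ 0) (hv : v ≠ 0)
    (hQ : (b₁ + u * (c₁ - b₁) - x) ^ 2 + (b₂ + u * (c₂ - b₂) - y) ^ 2 =
      (c₁ - x) ^ 2 + (c₂ - y) ^ 2)
    (hR : ((1 - v) * c₁ - x) ^ 2 + ((1 - v) * c₂ - y) ^ 2 =
      (c₁ - x) ^ 2 + (c₂ - y) ^ 2) :
    (t * b₁ - x) ^ 2 + (t * b₂ - y) ^ 2 - ((c₁ - x) ^ 2 + (c₂ - y) ^ 2) =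
      (1 - t) * (1 - v) * (c₁ ^ 2 + c₂ ^ 2) + t * u * ((c₁ - b₁) ^ 2 + (c₂ - b₂) ^ 2) -
        t * (1 - t) * (b₁ ^ 2 + b₂ ^ 2) := by
  have hA : x ^ 2 + y ^ 2 - ((c₁ - x) ^ 2 + (c₂ - y) ^ 2) =
      (1 - v) * (c₁ ^ 2 + c₂ ^ 2) := mul_left_cancel₀ hv (by linear_combination hR)
  have hB : (b₁ - x) ^ 2 + (b₂ - y) ^ 2 - ((c₁ - x) ^ 2 + (c₂ - y) ^ 2) =
      u * ((c₁ - b₁) ^ 2 + (c₂ - b₂) ^ 2) :=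
    mul_left_cancel₀ hu' (by linear_combination hQ)
  linear_combination (1 - t) * hA + t * hB

/-- The reflection of `P` in the line of centers of the circles `ARP` and `BPQ` lies on the
circle `CQR`; here `A` is the origin, `b = B - A`, `c = C - A`, and `(xᵢ, yᵢ)` are the
centers of the circles. -/
lemma miquel_identity {b₁ b₂ c₁ c₂ t u v x₁ y₁ x₂ y₂ x₃ y₃ : ℝ}
    (hD : b₁ * c₂ - b₂ * c₁ ≠ 0) (ht : t ≠ 0) (ht' : 1 - t ≠ 0) (hu : u ≠ 0)
    (hu' : 1 - u ≠ 0) (hv : v ≠ 0) (hv' : 1 - v ≠ 0)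
    (hP₁ : (t * b₁ - x₁) ^ 2 + (t * b₂ - y₁) ^ 2 = x₁ ^ 2 + y₁ ^ 2)
    (hR₁ : ((1 - v) * c₁ - x₁) ^ 2 + ((1 - v) * c₂ - y₁) ^ 2 = x₁ ^ 2 + y₁ ^ 2)
    (hP₂ : (t * b₁ - x₂) ^ 2 + (t * b₂ - y₂) ^ 2 = (b₁ - x₂) ^ 2 + (b₂ - y₂) ^ 2)
    (hQ₂ : (b₁ + u * (c₁ - b₁) - x₂) ^ 2 + (b₂ + u * (c₂ - b₂) - y₂) ^ 2 =
      (b₁ - x₂) ^ 2 + (b₂ - y₂) ^ 2)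
    (hQ₃ : (b₁ + u * (c₁ - b₁) - x₃) ^ 2 + (b₂ + u * (c₂ - b₂) - y₃) ^ 2 =
      (c₁ - x₃) ^ 2 + (c₂ - y₃) ^ 2)
    (hR₃ : ((1 - v) * c₁ - x₃) ^ 2 + ((1 - v) * c₂ - y₃) ^ 2 =
      (c₁ - x₃) ^ 2 + (c₂ - y₃) ^ 2) :
    ((t * b₁ - x₃) ^ 2 + (t * b₂ - y₃) ^ 2 - ((c₁ - x₃) ^ 2 + (c₂ - y₃) ^ 2)) *
        ((x₂ - x₁) ^ 2 + (y₂ - y₁) ^ 2) =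
      4 * ((t * b₂ - y₁) * (x₂ - x₁) - (t * b₁ - x₁) * (y₂ - y₁)) *
        ((y₁ - y₃) * (x₂ - x₁) - (x₁ - x₃) * (y₂ - y₁)) := by
  obtain ⟨hx₁, hy₁⟩ := center_coords ht hv' hP₁ hR₁
  obtain ⟨hx₂, hy₂⟩ := center_coords (b₁ := c₁ - b₁) (b₂ := c₂ - b₂) (c₁ := -b₁) (c₂ := -b₂)
    (s := u) (t := 1 - t) (x := x₂ - b₁) (y := y₂ - b₂) hu ht'
    (by linear_combination hQ₂) (by linear_combination hP₂)
  obtain ⟨hx₃, hy₃⟩ := center_coords (b₁ := -c₁) (b₂ := -c₂) (c₁ := b₁ - c₁) (c₂ := b₂ - c₂)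
    (s := v) (t := 1 - u) (x := x₃ - c₁) (y := y₃ - c₂) hv hu'
    (by linear_combination hR₃) (by linear_combination hQ₃)
  obtain ⟨β, hβ⟩ : ∃ β, β = b₁ ^ 2 + b₂ ^ 2 := ⟨_, rfl⟩
  obtain ⟨γ, hγ⟩ : ∃ γ, γ = c₁ ^ 2 + c₂ ^ 2 := ⟨_, rfl⟩
  obtain ⟨δ, hδ⟩ : ∃ δ, δ = b₁ * c₁ + b₂ * c₂ := ⟨_, rfl⟩
  obtain ⟨q, hq⟩ : ∃ q, q = (1 - t) * β - u * (β + γ - 2 * δ) - 2 * δ + (1 - v) * γ :=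
    ⟨_, rfl⟩
  have hdx : 2 * (b₁ * c₂ - b₂ * c₁) * (x₂ - x₁) = β * c₂ + q * b₂ := by
    rw [hq, hβ, hγ, hδ]; linear_combination hx₂ - hx₁
  have hdy : 2 * (b₁ * c₂ - b₂ * c₁) * (y₂ - y₁) = -(β * c₁ + q * b₁) := by
    rw [hq, hβ, hγ, hδ]; linear_combination hy₂ - hy₁
  have hN : 4 * (b₁ * c₂ - b₂ * c₁) ^ 2 * ((x₂ - x₁) ^ 2 + (y₂ - y₁) ^ 2) =
      β ^ 2 * γ + 2 * β * q * δ + q ^ 2 * β := by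
    calc
      _ = (2 * (b₁ * c₂ - b₂ * c₁) * (x₂ - x₁)) ^ 2 +
          (2 * (b₁ * c₂ - b₂ * c₁) * (y₂ - y₁)) ^ 2 := by ring
      _ = β ^ 2 * (c₁ ^ 2 + c₂ ^ 2) + 2 * β * q * (b₁ * c₁ + b₂ * c₂) +
          q ^ 2 * (b₁ ^ 2 + b₂ ^ 2) := by rw [hdx, hdy]; ring
      _ = _ := by rw [← hβ, ← hγ, ← hδ]
  have hw := cross_eq_of_rotated_coords (x := t * b₁ - x₁) (y := t * b₂ - y₁) (p := t * β)
    (q := (1 - v) * γ - 2 * t * δ) hD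
    (by rw [hβ, hγ, hδ]; linear_combination -hx₁)
    (by rw [hβ, hγ, hδ]; linear_combination -hy₁) hdx hdy
  have ho := cross_eq_of_rotated_coords (x := x₁ - x₃) (y := y₁ - y₃)
    (p := t * β - 2 * δ + v * γ - (1 - u) * (β + γ - 2 * δ)) (q := γ) hD
    (by rw [hβ, hγ, hδ]; linear_combination hx₁ - hx₃)
    (by rw [hβ, hγ, hδ]; linear_combination hy₁ - hy₃) hdx hdy
  have hF : (t * b₁ - x₃) ^ 2 + (t * b₂ - y₃) ^ 2 - ((c₁ - x₃) ^ 2 + (c₂ - y₃) ^ 2) =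
      (1 - t) * (1 - v) * γ + t * u * (β + γ - 2 * δ) - t * (1 - t) * β := by
    rw [power_eq hu' hv hQ₃ hR₃, hβ, hγ, hδ]; ring
  have hD' : 4 * (b₁ * c₂ - b₂ * c₁) ^ 2 ≠ 0 := by positivity
  apply mul_left_cancel₀ hD'
  rw [hF, mul_left_comm, hN]
  calc
    _ = (t * β * q - ((1 - v) * γ - 2 * t * δ) * β) *
        ((t * β - 2 * δ + v * γ - (1 - u) * (β + γ - 2 * δ)) * q - γ * β) := by
      rw [hq]; ring
    _ = _ := by rw [← hw, ← ho]; ring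

/-- A point common to three circles, the first two of which pass through `(p₁, p₂)`, namely
the reflection of `(p₁, p₂)` in the line of centers of the first two circles. -/
lemma exists_common_point {p₁ p₂ x₁ y₁ x₂ y₂ x₃ y₃ r : ℝ}
    (hN : (x₂ - x₁) ^ 2 + (y₂ - y₁) ^ 2 ≠ 0)
    (h : ((p₁ - x₃) ^ 2 + (p₂ - y₃) ^ 2 - r) * ((x₂ - x₁) ^ 2 + (y₂ - y₁) ^ 2) =
      4 * ((p₂ - y₁) * (x₂ - x₁) - (p₁ - x₁) * (y₂ - y₁)) *
        ((y₁ - y₃) * (x₂ - x₁) - (x₁ - x₃) * (y₂ - y₁))) :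
    ∃ z : ℂ, (z.re - x₁) ^ 2 + (z.im - y₁) ^ 2 = (p₁ - x₁) ^ 2 + (p₂ - y₁) ^ 2 ∧
      (z.re - x₂) ^ 2 + (z.im - y₂) ^ 2 = (p₁ - x₂) ^ 2 + (p₂ - y₂) ^ 2 ∧
      (z.re - x₃) ^ 2 + (z.im - y₃) ^ 2 = r := by
  obtain ⟨k, hk⟩ : ∃ k, k * ((x₂ - x₁) ^ 2 + (y₂ - y₁) ^ 2) =
      (p₂ - y₁) * (x₂ - x₁) - (p₁ - x₁) * (y₂ - y₁) := ⟨_, div_mul_cancel₀ _ hN⟩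
  have h' : (p₁ - x₃) ^ 2 + (p₂ - y₃) ^ 2 - r =
      4 * k * ((y₁ - y₃) * (x₂ - x₁) - (x₁ - x₃) * (y₂ - y₁)) := by
    apply mul_right_cancel₀ hN
    rw [h, ← hk]
    ring
  refine ⟨⟨p₁ + 2 * k * (y₂ - y₁), p₂ - 2 * k * (x₂ - x₁)⟩, ?_, ?_, ?_⟩
  · linear_combination 4 * k * hk
  · linear_combination 4 * k * hk
  · linear_combination h' + 4 * k * hk


/-- Miquel's pivot theorem: for non-collinear points `A B C` in the plane (identified
with `ℂ`), with `P` on line `AB` (`P ≠ A, B`), `Q` on line `BC` (`Q ≠ B, C`) and `R`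
on line `CA` (`R ≠ C, A`), the circumcircle of `A, R, P`, the circumcircle of
`B, P, Q` and the circumcircle of `C, Q, R` have a common point `S`. -/
theorem miquel_pivot
    (A B C P Q R : ℂ)
    (hABC : ¬ Collinear ℝ ({A, B, C} : Set ℂ))
    (hP : Collinear ℝ ({A, B, P} : Set ℂ)) (hPA : P ≠ A) (hPB : P ≠ B)
    (hQ : Collinear ℝ ({B, C, Q} : Set ℂ)) (hQB : Q ≠ B) (hQC : Q ≠ C)
    (hR : Collinear ℝ ({C, A, R} : Set ℂ)) (hRC : R ≠ C) (hRA : R ≠ A)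
    (s₁ s₂ s₃ : EuclideanGeometry.Sphere ℂ)
    (hA₁ : A ∈ s₁) (hR₁ : R ∈ s₁) (hP₁ : P ∈ s₁)
    (hB₂ : B ∈ s₂) (hP₂ : P ∈ s₂) (hQ₂ : Q ∈ s₂)
    (hC₃ : C ∈ s₃) (hQ₃ : Q ∈ s₃) (hR₃ : R ∈ s₃) :
    ∃ S : ℂ, S ∈ s₁ ∧ S ∈ s₂ ∧ S ∈ s₃ := by
  have hAB : A ≠ B := by
    rintro rfl
    exact hABC (by simpa using collinear_pair ℝ A C)
  have hBC : B ≠ C := by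
    rintro rfl
    exact hABC (by simpa using collinear_pair ℝ A B)
  have hCA : C ≠ A := by
    rintro rfl
    exact hABC (collinear_of_cross_eq_zero (by ring))
  have hD := mt collinear_of_cross_eq_zero hABC
  obtain ⟨t, hPre, hPim⟩ := exists_coords_of_collinear hAB hP
  obtain ⟨u, hQre, hQim⟩ := exists_coords_of_collinear hBC hQ
  obtain ⟨v, hRre, hRim⟩ := exists_coords_of_collinear hCA hR
  have ht : t ≠ 0 := by
    rintro rfl
    exact hPA (Complex.ext (by linarith) (by linarith))
  have ht' : 1 - t ≠ 0 := by
    intro h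
    obtain rfl : t = 1 := by linarith
    exact hPB (Complex.ext (by linarith) (by linarith))
  have hu : u ≠ 0 := by
    rintro rfl
    exact hQB (Complex.ext (by linarith) (by linarith))
  have hu' : 1 - u ≠ 0 := by
    intro h
    obtain rfl : u = 1 := by linarith
    exact hQC (Complex.ext (by linarith) (by linarith))
  have hv : v ≠ 0 := by
    rintro rfl
    exact hRC (Complex.ext (by linarith) (by linarith))
  have hv' : 1 - v ≠ 0 := by
    intro h
    obtain rfl : v = 1 := by linarith
    exact hRA (Complex.ext (by linarith) (by linarith))
  have eP₁ := normSq_sub_center_eq hP₁ hA₁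
  have eR₁ := normSq_sub_center_eq hR₁ hA₁
  have eP₂ := normSq_sub_center_eq hP₂ hB₂
  have eQ₂ := normSq_sub_center_eq hQ₂ hB₂
  have eQ₃ := normSq_sub_center_eq hQ₃ hC₃
  have eR₃ := normSq_sub_center_eq hR₃ hC₃
  rw [hPre, hPim] at eP₁ eP₂
  rw [hQre, hQim] at eQ₂ eQ₃
  rw [hRre, hRim] at eR₁ eR₃
  have key := miquel_identity (b₁ := B.re - A.re) (b₂ := B.im - A.im) (c₁ := C.re - A.re)
    (c₂ := C.im - A.im) (x₁ := s₁.center.re - A.re) (y₁ := s₁.center.im - A.im)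
    (x₂ := s₂.center.re - A.re) (y₂ := s₂.center.im - A.im)
    (x₃ := s₃.center.re - A.re) (y₃ := s₃.center.im - A.im)
    hD ht ht' hu hu' hv hv' (by linear_combination eP₁) (by linear_combination eR₁)
    (by linear_combination eP₂) (by linear_combination eQ₂) (by linear_combination eQ₃)
    (by linear_combination eR₃)
  have hN : (s₂.center.re - s₁.center.re) ^ 2 + (s₂.center.im - s₁.center.im) ^ 2 ≠ 0 := by
    intro h0
    rw [eq_of_sq_add_sq_eq_zero h0] at eP₂
    have h : t * ((1 - t) * ((B.re - A.re) ^ 2 + (B.im - A.im) ^ 2)) = 0 := by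
      linear_combination (t - 1) * eP₁ - t * eP₂
    have h' := (mul_eq_zero.1 ((mul_eq_zero.1 h).resolve_left ht)).resolve_left ht'
    exact hAB (eq_of_sq_add_sq_eq_zero h').symm
  obtain ⟨S, h₁, h₂, h₃⟩ := exists_common_point (p₁ := P.re) (p₂ := P.im)
    (x₃ := s₃.center.re) (y₃ := s₃.center.im)
    (r := (C.re - s₃.center.re) ^ 2 + (C.im - s₃.center.im) ^ 2) hN
    (by rw [hPre, hPim]; linear_combination key)
  exact ⟨S, mem_sphere_of_normSq_eq hP₁ h₁, mem_sphere_of_normSq_eq hP₂ h₂,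
    mem_sphere_of_normSq_eq hC₃ h₃⟩
end

section
/- In the singular Miquel configuration, let S be a common point of the circumcircles of A, R, P; of B, P, Q; and of C, Q, R, with S ≠ A. Then A, S, Q are collinear. -/
/-- The power of a point with respect to a sphere, in barycentric coordinates. -/
lemma EuclideanGeometry.Sphere.power_barycentric (s : EuclideanGeometry.Sphere ℂ)
    (A B C : ℂ) (x y : ℝ) :
    s.power (A + x * (B - A) + y * (C - A)) =
      (1 - x - y) * s.power A + x * s.power B + y * s.power C
        - ((1 - x - y) * x * dist A B ^ 2 + (1 - x - y) * y * dist A C ^ 2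
          + x * y * dist B C ^ 2) := by
  simp only [EuclideanGeometry.Sphere.power, Complex.dist_eq, Complex.sq_norm,
    Complex.normSq_apply, Complex.add_re, Complex.add_im, Complex.sub_re, Complex.sub_im,
    Complex.mul_re, Complex.mul_im, Complex.ofReal_re, Complex.ofReal_im]
  ring

lemma EuclideanGeometry.Sphere.power_eq_zero_of_mem {s : EuclideanGeometry.Sphere ℂ} {X : ℂ}
    (h : X ∈ s) : s.power X = 0 := by
  rw [EuclideanGeometry.Sphere.power, EuclideanGeometry.mem_sphere.mp h, sub_self]

lemma exists_eq_add_mul_of_collinear {A B X : ℂ} (h : Collinear ℝ ({A, B, X} : Set ℂ))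
    (hAB : A ≠ B) : ∃ t : ℝ, X = A + t * (B - A) := by
  have hX : X ∈ line[ℝ, A, B] :=
    h.mem_affineSpan_of_mem_of_ne (by simp) (by simp) (by simp) hAB
  obtain ⟨t, rfl⟩ := mem_affineSpan_pair_iff_exists_lineMap_eq.mp hX
  exact ⟨t, by simp [AffineMap.lineMap_apply, add_comm]⟩

lemma collinear_add_mul (A B : ℂ) (t : ℝ) :
    Collinear ℝ ({A, A + t * (B - A), B} : Set ℂ) := by
  rw [Set.insert_comm]
  refine collinear_insert_of_mem_affineSpan_pair
    (mem_affineSpan_pair_iff_exists_lineMap_eq.mpr ⟨t, ?_⟩)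
  simp [AffineMap.lineMap_apply, add_comm]

lemma exists_barycentric_of_not_collinear {A B C : ℂ}
    (h : ¬ Collinear ℝ ({A, B, C} : Set ℂ)) (X : ℂ) :
    ∃ x y : ℝ, X = A + x * (B - A) + y * (C - A) := by
  have hdet : (B - A).re * (C - A).im - (B - A).im * (C - A).re ≠ 0 := by
    intro h0
    apply h
    by_cases hCA : C = A
    · subst hCA
      simpa [Set.insert_comm] using collinear_pair ℝ B C
    have hN : Complex.normSq (C - A) ≠ 0 := by
      simpa [sub_eq_zero] using hCA
    have hB : B = A + ((((B - A).re * (C - A).re + (B - A).im * (C - A).im) /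
        Complex.normSq (C - A) : ℝ) : ℂ) * (C - A) := by
      rw [← sub_eq_iff_eq_add']
      apply Complex.ext
      · rw [Complex.re_ofReal_mul]
        field_simp
        rw [Complex.normSq_apply]
        linear_combination (C - A).im * h0
      · rw [Complex.im_ofReal_mul]
        field_simp
        rw [Complex.normSq_apply]
        linear_combination -(C - A).re * h0
    rw [hB]
    exact collinear_add_mul A C _
  set D := (B - A).re * (C - A).im - (B - A).im * (C - A).re with hD
  refine ⟨((X - A).re * (C - A).im - (X - A).im * (C - A).re) / D,
    ((B - A).re * (X - A).im - (B - A).im * (X - A).re) / D, ?_⟩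
  rw [add_assoc, ← sub_eq_iff_eq_add']
  apply Complex.ext
  · rw [Complex.add_re, Complex.re_ofReal_mul, Complex.re_ofReal_mul]
    field_simp
    rw [hD]
    ring
  · rw [Complex.add_im, Complex.im_ofReal_mul, Complex.im_ofReal_mul]
    field_simp
    rw [hD]
    ring


/-- In the singular Miquel configuration, if `S` is a common point of the
circumcircles of `A, R, P`; of `B, P, Q`; and of `C, Q, R`, with `S ≠ A`,
then `A`, `S`, `Q` are collinear. -/
theorem singular_miquel_ASQ_collinear
    (A B C P Q R : ℂ)
    (hABC : ¬ Collinear ℝ ({A, B, C} : Set ℂ))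
    (hP : Collinear ℝ ({A, B, P} : Set ℂ)) (hPA : P ≠ A) (hPB : P ≠ B)
    -- Q is the second intersection of the circumcircle of A, P, C with line BC
    (sAPC : EuclideanGeometry.Sphere ℂ)
    (hA₁ : A ∈ sAPC) (hP₁ : P ∈ sAPC) (hC₁ : C ∈ sAPC) (hQ₁ : Q ∈ sAPC)
    (hQ : Collinear ℝ ({B, C, Q} : Set ℂ)) (hQC : Q ≠ C)
    -- R is the second intersection of the circumcircle of B, P, C with line CA
    (sBPC : EuclideanGeometry.Sphere ℂ)
    (hB₂ : B ∈ sBPC) (hP₂ : P ∈ sBPC) (hC₂ : C ∈ sBPC) (hR₂ : R ∈ sBPC)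
    (hR : Collinear ℝ ({C, A, R} : Set ℂ)) (hRC : R ≠ C)
    -- P, Q, R are distinct from all of A, B, C
    (hPC : P ≠ C) (hQA : Q ≠ A) (hQB : Q ≠ B) (hRA : R ≠ A) (hRB : R ≠ B)
    (hARP : ¬ Collinear ℝ ({A, R, P} : Set ℂ))
    (hBPQ : ¬ Collinear ℝ ({B, P, Q} : Set ℂ))
    (hCQR : ¬ Collinear ℝ ({C, Q, R} : Set ℂ))
    (s₁ s₂ s₃ : EuclideanGeometry.Sphere ℂ)
    (hs₁A : A ∈ s₁) (hs₁R : R ∈ s₁) (hs₁P : P ∈ s₁)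
    (hs₂B : B ∈ s₂) (hs₂P : P ∈ s₂) (hs₂Q : Q ∈ s₂)
    (hs₃C : C ∈ s₃) (hs₃Q : Q ∈ s₃) (hs₃R : R ∈ s₃)
    (S : ℂ) (hS₁ : S ∈ s₁) (hS₂ : S ∈ s₂) (hS₃ : S ∈ s₃) (hSA : S ≠ A) :
    Collinear ℝ ({A, S, Q} : Set ℂ) := by
  have hAB : A ≠ B := by
    rintro rfl
    exact hABC (by simpa using collinear_pair ℝ A C)
  have hBC : B ≠ C := by
    rintro rfl
    exact hABC (by simpa using collinear_pair ℝ A B)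
  have hCA : C ≠ A := by
    rintro rfl
    exact hABC (by simpa [Set.insert_comm] using collinear_pair ℝ B C)
  obtain ⟨p, hp⟩ := exists_eq_add_mul_of_collinear hP hAB
  obtain ⟨q, hq⟩ := exists_eq_add_mul_of_collinear hQ hBC
  obtain ⟨r, hr⟩ := exists_eq_add_mul_of_collinear
    (by rwa [Set.insert_comm] at hR) hCA.symm
  obtain ⟨x, y, hS⟩ := exists_barycentric_of_not_collinear hABC S
  have hp1 : 1 - p ≠ 0 := by
    intro h
    obtain rfl : p = 1 := by linarith
    exact hPB (by simp [hp])
  have hq0 : q ≠ 0 := by rintro rfl; exact hQB (by simp [hq])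
  have hq1 : 1 - q ≠ 0 := by
    intro h
    obtain rfl : q = 1 := by linarith
    exact hQC (by simp [hq])
  have hr1 : 1 - r ≠ 0 := by
    intro h
    obtain rfl : r = 1 := by linarith
    exact hRC (by simp [hr])
  have powP (s : EuclideanGeometry.Sphere ℂ) (h : P ∈ s) := by
    have := s.power_barycentric A B C p 0
    rwa [show A + (p : ℂ) * (B - A) + ((0 : ℝ) : ℂ) * (C - A) = P by rw [hp]; push_cast; ring,
      s.power_eq_zero_of_mem h] at this
  have powQ (s : EuclideanGeometry.Sphere ℂ) (h : Q ∈ s) := by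
    have := s.power_barycentric A B C (1 - q) q
    rwa [show A + ((1 - q : ℝ) : ℂ) * (B - A) + (q : ℂ) * (C - A) = Q by
      rw [hq]; push_cast; ring, s.power_eq_zero_of_mem h] at this
  have powR (s : EuclideanGeometry.Sphere ℂ) (h : R ∈ s) := by
    have := s.power_barycentric A B C 0 r
    rwa [show A + ((0 : ℝ) : ℂ) * (B - A) + (r : ℂ) * (C - A) = R by rw [hr]; push_cast; ring,
      s.power_eq_zero_of_mem h] at this
  have powS (s : EuclideanGeometry.Sphere ℂ) (h : S ∈ s) := by
    have := s.power_barycentric A B C x y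
    rwa [← hS, s.power_eq_zero_of_mem h] at this
  have he0 : dist B C ^ 2 ≠ 0 := pow_ne_zero 2 (dist_ne_zero.mpr hBC)
  have powA₂ : sBPC.power A = p * dist A B ^ 2 := by
    have h := powP _ hP₂
    rw [sBPC.power_eq_zero_of_mem hB₂, sBPC.power_eq_zero_of_mem hC₂] at h
    apply mul_left_cancel₀ hp1
    linear_combination -h
  have hrc : r * dist A C ^ 2 = p * dist A B ^ 2 := by
    have h := powR _ hR₂
    rw [sBPC.power_eq_zero_of_mem hB₂, sBPC.power_eq_zero_of_mem hC₂, powA₂] at h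
    apply mul_left_cancel₀ hr1
    linear_combination h
  have powA₂' : s₂.power A = p * dist A B ^ 2 := by
    have h := powP _ hs₂P
    rw [s₂.power_eq_zero_of_mem hs₂B] at h
    apply mul_left_cancel₀ hp1
    linear_combination -h
  have powC₂ : s₂.power C = (1 - q) * dist B C ^ 2 := by
    have h := powQ _ hs₂Q
    rw [s₂.power_eq_zero_of_mem hs₂B] at h
    apply mul_left_cancel₀ hq0
    linear_combination -h
  have powA₃ : s₃.power A = r * dist A C ^ 2 := by
    have h := powR _ hs₃R
    rw [s₃.power_eq_zero_of_mem hs₃C] at h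
    apply mul_left_cancel₀ hr1
    linear_combination -h
  have powB₃ : s₃.power B = q * dist B C ^ 2 := by
    have h := powQ _ hs₃Q
    rw [s₃.power_eq_zero_of_mem hs₃C] at h
    apply mul_left_cancel₀ hq1
    linear_combination -h
  have hxy : (1 - q) * y = q * x := by
    have h₂ := powS _ hS₂
    have h₃ := powS _ hS₃
    rw [s₂.power_eq_zero_of_mem hs₂B, powA₂', powC₂] at h₂
    rw [s₃.power_eq_zero_of_mem hs₃C, powA₃, powB₃] at h₃
    apply mul_left_cancel₀ he0
    linear_combination h₃ - h₂ + (1 - x - y) * hrc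
  have hSQ : S = A + ((x + y : ℝ) : ℂ) * (Q - A) := by
    have hxy' : (1 - (q : ℂ)) * y = q * x := mod_cast hxy
    rw [hS, hq]
    push_cast
    linear_combination (C - B) * hxy'
  rw [hSQ]
  exact collinear_add_mul A Q _
end

section
/- In the singular Miquel configuration, let S be a common point of the circumcircles of A, R, P; of B, P, Q; and of C, Q, R, with S ≠ B. Then B, S, R are collinear. -/
open EuclideanGeometry in
theorem EuclideanGeometry.collinear_iff_two_zsmul_oangle_eq_zero {V P : Type*}
    [NormedAddCommGroup V] [InnerProductSpace ℝ V] [MetricSpace P] [NormedAddTorsor V P]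
    [Fact (Module.finrank ℝ V = 2)] [Module.Oriented ℝ V (Fin 2)] {p₁ p₂ p₃ : P} :
    Collinear ℝ {p₁, p₂, p₃} ↔ (2 : ℤ) • ∡ p₁ p₂ p₃ = 0 := by
  rw [Real.Angle.two_zsmul_eq_zero_iff, oangle_eq_zero_or_eq_pi_iff_collinear]

/-- In the singular Miquel configuration, if `S` is a common point of the
circumcircles of `A, R, P`; of `B, P, Q`; and of `C, Q, R`, with `S ≠ B`,
then `B`, `S`, `R` are collinear. -/
theorem singular_miquel_BSR_collinear
    (A B C P Q R : ℂ)
    (hABC : ¬ Collinear ℝ ({A, B, C} : Set ℂ))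
    (hP : Collinear ℝ ({A, B, P} : Set ℂ)) (hPA : P ≠ A) (hPB : P ≠ B)
    -- Q is the second intersection of the circumcircle of A, P, C with line BC
    (sAPC : EuclideanGeometry.Sphere ℂ)
    (hA₁ : A ∈ sAPC) (hP₁ : P ∈ sAPC) (hC₁ : C ∈ sAPC) (hQ₁ : Q ∈ sAPC)
    (hQ : Collinear ℝ ({B, C, Q} : Set ℂ)) (hQC : Q ≠ C)
    -- R is the second intersection of the circumcircle of B, P, C with line CA
    (sBPC : EuclideanGeometry.Sphere ℂ)
    (hB₂ : B ∈ sBPC) (hP₂ : P ∈ sBPC) (hC₂ : C ∈ sBPC) (hR₂ : R ∈ sBPC)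
    (hR : Collinear ℝ ({C, A, R} : Set ℂ)) (hRC : R ≠ C)
    -- P, Q, R are distinct from all of A, B, C
    (hPC : P ≠ C) (hQA : Q ≠ A) (hQB : Q ≠ B) (hRA : R ≠ A) (hRB : R ≠ B)
    (hARP : ¬ Collinear ℝ ({A, R, P} : Set ℂ))
    (hBPQ : ¬ Collinear ℝ ({B, P, Q} : Set ℂ))
    (hCQR : ¬ Collinear ℝ ({C, Q, R} : Set ℂ))
    (s₁ s₂ s₃ : EuclideanGeometry.Sphere ℂ)
    (hs₁A : A ∈ s₁) (hs₁R : R ∈ s₁) (hs₁P : P ∈ s₁)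
    (hs₂B : B ∈ s₂) (hs₂P : P ∈ s₂) (hs₂Q : Q ∈ s₂)
    (hs₃C : C ∈ s₃) (hs₃Q : Q ∈ s₃) (hs₃R : R ∈ s₃)
    (S : ℂ) (hS₁ : S ∈ s₁) (hS₂ : S ∈ s₂) (hS₃ : S ∈ s₃) (hSB : S ≠ B) :
    Collinear ℝ ({B, S, R} : Set ℂ) := by
  have : Fact (Module.finrank ℝ ℂ = 2) := Complex.finrank_real_complex_fact
  let _ : Module.Oriented ℝ ℂ (Fin 2) := ⟨Complex.orientation⟩
  have cosph {s : EuclideanGeometry.Sphere ℂ} {a b c d : ℂ} (ha : a ∈ s) (hb : b ∈ s)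
      (hc : c ∈ s) (hd : d ∈ s) (hba : b ≠ a) (hbd : b ≠ d) (hca : c ≠ a) (hcd : c ≠ d) :
      (2 : ℤ) • EuclideanGeometry.oangle a b d = (2 : ℤ) • EuclideanGeometry.oangle a c d :=
    EuclideanGeometry.Sphere.two_zsmul_oangle_eq ha hb hc hd hba hbd hca hcd
  have hPQ : P ≠ Q := by
    rintro rfl
    exact hBPQ (by simpa using collinear_pair ℝ B P)
  have hPR : P ≠ R := by
    rintro rfl
    exact hARP (by simpa using collinear_pair ℝ A P)
  have hCA : C ≠ A := by
    rintro rfl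
    exact hABC (by simpa [Set.insert_comm] using collinear_pair ℝ B C)
  have hQ_A : (2 : ℤ) • EuclideanGeometry.oangle C Q P
      = (2 : ℤ) • EuclideanGeometry.oangle R A P := by
    rw [cosph hC₁ hQ₁ hA₁ hP₁ hQC hPQ.symm hCA.symm hPA.symm]
    exact Collinear.two_zsmul_oangle_eq_left hR hCA hRA
  have hSP : S ≠ P := by
    rintro rfl
    refine hARP ?_
    have h₁ : (2 : ℤ) • EuclideanGeometry.oangle A R S
        = (2 : ℤ) • EuclideanGeometry.oangle R A S := by
      rw [← hQ_A, cosph hs₃C hs₃Q hs₃R hS₃ hQC hPQ.symm hRC hPR.symm]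
      exact Collinear.two_zsmul_oangle_eq_left (Set.pair_comm A R ▸ hR) hRC.symm hRA.symm |>.symm
    have h₂ := congrArg ((2 : ℤ) • ·)
      (EuclideanGeometry.oangle_add_oangle_add_oangle_eq_pi (p₁ := A) (p₂ := R) (p₃ := S)
        hRA hPR hPA.symm)
    have h₃ : Collinear ℝ {R, S, A} := by
      rw [EuclideanGeometry.collinear_iff_two_zsmul_oangle_eq_zero]
      simpa [smul_add, h₁, EuclideanGeometry.oangle_rev R A S] using h₂
    rwa [Set.pair_comm S A, Set.insert_comm R A] at h₃
  rcases eq_or_ne S R with rfl | hSR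
  · simpa using collinear_pair ℝ B S
  have hBSP : (2 : ℤ) • EuclideanGeometry.oangle B S P
      = (2 : ℤ) • EuclideanGeometry.oangle C Q P := by
    rw [cosph hs₂B hS₂ hs₂Q hs₂P hSB hSP hQB hPQ.symm]
    exact Collinear.two_zsmul_oangle_eq_left (Set.pair_comm C Q ▸ hQ) hQB.symm hQC.symm
  have hPSR := cosph hs₁P hS₁ hs₁A hs₁R hSP hSR hPA.symm hRA.symm
  rw [EuclideanGeometry.collinear_iff_two_zsmul_oangle_eq_zero,
    ← EuclideanGeometry.oangle_add hSB.symm hSP.symm hSR.symm, smul_add, hBSP, hPSR, hQ_A,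
    ← smul_add, EuclideanGeometry.oangle_add_oangle_rev, smul_zero]
end

section
/- In the singular Miquel configuration, let S be a point lying on both line AQ and line BR, with lines AQ and BR distinct. Then S lies on the circumcircle of A, R, P. -/
/-- Power of a point along a secant, with the second intersection given by an affine parameter. -/
theorem EuclideanGeometry.Sphere.power_eq_mul_norm_sq_of_lineMap_mem
    {V : Type*} [NormedAddCommGroup V] [InnerProductSpace ℝ V] {s : EuclideanGeometry.Sphere V}
    {X Y : V} {p : ℝ} (hY : Y ∈ s) (hp : AffineMap.lineMap X Y p ∈ s) (hne : p ≠ 1) :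
    s.power X = p * ‖Y - X‖ ^ 2 := by
  rw [EuclideanGeometry.mem_sphere, dist_eq_norm] at hY hp
  have h₁ : Y - s.center = (Y - X) - (s.center - X) := by abel
  have h₂ : AffineMap.lineMap X Y p - s.center = p • (Y - X) - (s.center - X) := by
    rw [AffineMap.lineMap_apply_module']; abel
  replace hY := congrArg (· ^ 2) hY
  replace hp := congrArg (· ^ 2) hp
  simp only [h₁, h₂, norm_sub_sq_real (_ - X), norm_sub_sq_real (p • _), norm_smul,
    Real.norm_eq_abs, mul_pow, sq_abs, real_inner_smul_left] at hY hp
  rw [EuclideanGeometry.Sphere.power, dist_comm, dist_eq_norm]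
  refine mul_left_cancel₀ (sub_ne_zero.mpr hne) ?_
  linear_combination p * hY - hp

theorem Collinear.exists_lineMap_eq {k V : Type*} [DivisionRing k] [AddCommGroup V] [Module k V]
    {X Y Z : V} (h : Collinear k ({X, Y, Z} : Set V)) (hXY : X ≠ Y) :
    ∃ p : k, AffineMap.lineMap X Y p = Z :=
  mem_affineSpan_pair_iff_exists_lineMap_eq.mp <|
    h.mem_affineSpan_of_mem_of_ne (by simp) (by simp) (by simp) hXY

/-- In the singular Miquel configuration, if `S` lies on both line `AQ` and line
`BR`, with these two lines distinct, then `S` lies on the circumcircle of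
`A, R, P`. -/
theorem singular_miquel_S_mem_circle_ARP
    (A B C P Q R : ℂ)
    (hABC : ¬ Collinear ℝ ({A, B, C} : Set ℂ))
    (hP : Collinear ℝ ({A, B, P} : Set ℂ)) (hPA : P ≠ A) (hPB : P ≠ B)
    -- Q is the second intersection of the circumcircle of A, P, C with line BC
    (sAPC : EuclideanGeometry.Sphere ℂ)
    (hA₁ : A ∈ sAPC) (hP₁ : P ∈ sAPC) (hC₁ : C ∈ sAPC) (hQ₁ : Q ∈ sAPC)
    (hQ : Collinear ℝ ({B, C, Q} : Set ℂ)) (hQC : Q ≠ C)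
    -- R is the second intersection of the circumcircle of B, P, C with line CA
    (sBPC : EuclideanGeometry.Sphere ℂ)
    (hB₂ : B ∈ sBPC) (hP₂ : P ∈ sBPC) (hC₂ : C ∈ sBPC) (hR₂ : R ∈ sBPC)
    (hR : Collinear ℝ ({C, A, R} : Set ℂ)) (hRC : R ≠ C)
    -- P, Q, R are distinct from all of A, B, C
    (hPC : P ≠ C) (hQA : Q ≠ A) (hQB : Q ≠ B) (hRA : R ≠ A) (hRB : R ≠ B)
    (hARP : ¬ Collinear ℝ ({A, R, P} : Set ℂ))
    (S : ℂ) (hSAQ : S ∈ line[ℝ, A, Q]) (hSBR : S ∈ line[ℝ, B, R])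
    (hlines : line[ℝ, A, Q] ≠ line[ℝ, B, R])
    (s₁ : EuclideanGeometry.Sphere ℂ)
    (hs₁A : A ∈ s₁) (hs₁R : R ∈ s₁) (hs₁P : P ∈ s₁) :
    S ∈ s₁ := by
  have hind := affineIndependent_iff_not_collinear_set.mpr hABC
  have hAB : A ≠ B := hind.injective.ne (show (0 : Fin 3) ≠ 1 by decide)
  have hAC : A ≠ C := hind.injective.ne (show (0 : Fin 3) ≠ 2 by decide)
  have hBC : B ≠ C := hind.injective.ne (show (1 : Fin 3) ≠ 2 by decide)
  obtain ⟨p, rfl⟩ := hP.exists_lineMap_eq hAB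
  obtain ⟨q, rfl⟩ := hQ.exists_lineMap_eq hBC
  rw [Set.insert_comm] at hR
  obtain ⟨r, rfl⟩ := hR.exists_lineMap_eq hAC
  obtain ⟨s, hs⟩ := mem_affineSpan_pair_iff_exists_lineMap_eq.mp hSAQ
  obtain ⟨t, ht⟩ := mem_affineSpan_pair_iff_exists_lineMap_eq.mp hSBR
  have hp₀ : p ≠ 0 := by rintro rfl; simp at hPA
  have hp₁ : p ≠ 1 := by rintro rfl; simp at hPB
  have hq₁ : q ≠ 1 := by rintro rfl; simp at hQC
  have hr₀ : r ≠ 0 := by rintro rfl; simp at hRA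
  have hr₁ : r ≠ 1 := by rintro rfl; simp at hRC
  have powA := (sBPC.power_eq_mul_norm_sq_of_lineMap_mem hB₂ hP₂ hp₁).symm.trans
    (sBPC.power_eq_mul_norm_sq_of_lineMap_mem hC₂ hR₂ hr₁)
  rw [← AffineMap.lineMap_apply_one_sub] at hP₁
  have powB := (sAPC.power_eq_mul_norm_sq_of_lineMap_mem hA₁ hP₁ (by simpa using hp₀)).symm.trans
    (sAPC.power_eq_mul_norm_sq_of_lineMap_mem hC₁ hQ₁ hq₁)
  rw [← AffineMap.lineMap_apply_one_sub] at hs₁P hs₁R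
  have powB' := s₁.power_eq_mul_norm_sq_of_lineMap_mem hs₁A hs₁P (by simpa using hp₀)
  have powC' := s₁.power_eq_mul_norm_sq_of_lineMap_mem hs₁A hs₁R (by simpa using hr₀)
  simp only [AffineMap.lineMap_apply_module'] at hs ht
  have hlin : LinearIndependent ℝ ![B - A, C - A] := by
    rw [affineIndependent_iff_linearIndependent_vsub ℝ _ (0 : Fin 3)] at hind
    convert hind.comp (![⟨1, by decide⟩, ⟨2, by decide⟩] : Fin 2 → {x : Fin 3 // x ≠ 0})
      (by decide) using 1
    · ext i
      fin_cases i <;> simp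
    · rfl
    · rfl
  obtain ⟨hα, hβ⟩ := LinearIndependent.pair_iff.mp hlin (s * (1 - q) - (1 - t)) (s * q - t * r) (by
    linear_combination (norm := module) hs - ht)
  have hS : S - s₁.center = ((1 - t) • (B - A) + (t * r) • (C - A)) - (s₁.center - A) := by
    linear_combination (norm := module) -ht
  have hBO : B - s₁.center = (B - A) - (s₁.center - A) := by abel
  have hCO : C - s₁.center = (C - A) - (s₁.center - A) := by abel
  have hCB : C - B = (C - A) - (B - A) := by abel
  rw [EuclideanGeometry.mem_sphere, dist_comm, dist_eq_norm] at hs₁A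
  have hrad : 0 ≤ s₁.radius := hs₁A ▸ norm_nonneg _
  rw [EuclideanGeometry.mem_sphere, dist_eq_norm, ← sq_eq_sq₀ (norm_nonneg _) hrad]
  rw [EuclideanGeometry.Sphere.power, dist_eq_norm, norm_sub_rev A, ← hs₁A] at powB' powC'
  rw [norm_sub_rev A, hCB, norm_sub_sq_real (C - A)] at powB
  rw [hBO, norm_sub_sq_real (B - A)] at powB'
  rw [hCO, norm_sub_sq_real (C - A)] at powC'
  rw [hS, show 1 - t = s * (1 - q) by linarith, show t * r = s * q by linarith, ← hs₁A,
    norm_sub_sq_real (_ + _), norm_add_sq_real]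
  simp only [norm_smul, Real.norm_eq_abs, mul_pow, sq_abs, inner_add_left, real_inner_smul_left,
    real_inner_smul_right]
  rw [real_inner_comm] at powB
  linear_combination s * (1 - q) * powB' + s * q * powC' + (s * q - s * t) * powA +
    s ^ 2 * (1 - q) * powB + s * p * ‖B - A‖ ^ 2 * hα + s * ‖C - A‖ ^ 2 * hβ
end

section
/- In the singular Miquel configuration, let S be a point lying on both line AQ and line BR, with lines AQ and BR distinct. Then S lies on the circumcircle of B, P, Q. -/
open scoped RealInnerProductSpace

/-- If the line `X + ℝ d` meets a sphere with center `o` and radius `ρ` at the distinct parameters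
`x` and `y`, then the power of `X` is `x * y * ‖d‖ ^ 2`. -/
lemma power_eq_mul_of_dist_eq {V : Type*} [NormedAddCommGroup V] [InnerProductSpace ℝ V]
    {X d o : V} {ρ x y : ℝ} (hxy : x ≠ y)
    (hx : dist (X + x • d) o = ρ) (hy : dist (X + y • d) o = ρ) :
    ‖X - o‖ ^ 2 - ρ ^ 2 = x * y * ‖d‖ ^ 2 := by
  have expand (z : ℝ) : dist (X + z • d) o ^ 2
      = ‖X - o‖ ^ 2 + 2 * z * ⟪X - o, d⟫ + z ^ 2 * ‖d‖ ^ 2 := by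
    rw [dist_eq_norm, add_sub_right_comm, norm_add_sq_real, inner_smul_right, norm_smul, mul_pow,
      Real.norm_eq_abs, sq_abs]
    ring
  have ex := expand x
  have ey := expand y
  rw [hx] at ex
  rw [hy] at ey
  apply mul_left_cancel₀ (sub_ne_zero.2 hxy)
  linear_combination y * ex - x * ey

/-- A point `X + s • d` lies on a sphere through `X + d` if the power of `X` is `s * ‖d‖ ^ 2`. -/
lemma dist_eq_of_power_eq {V : Type*} [NormedAddCommGroup V] [InnerProductSpace ℝ V]
    {X d o : V} {ρ s : ℝ} (hd : dist (X + d) o = ρ)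
    (hs : ‖X - o‖ ^ 2 - ρ ^ 2 = s * ‖d‖ ^ 2) : dist (X + s • d) o = ρ := by
  have h1 : ρ ^ 2 = ‖X - o‖ ^ 2 + 2 * ⟪X - o, d⟫ + ‖d‖ ^ 2 := by
    rw [← hd, dist_eq_norm, add_sub_right_comm, norm_add_sq_real]
  have hρ : 0 ≤ ρ := hd ▸ dist_nonneg
  rw [← sq_eq_sq₀ dist_nonneg hρ, dist_eq_norm, add_sub_right_comm, norm_add_sq_real,
    inner_smul_right, norm_smul, mul_pow, Real.norm_eq_abs, sq_abs]
  linear_combination (1 - s) * hs - s * h1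

/-- **Stewart's theorem** in vector form. -/
lemma norm_sq_smul_add_smul {V : Type*} [NormedAddCommGroup V] [InnerProductSpace ℝ V]
    (u v : V) (q : ℝ) : ‖(1 - q) • u + q • v‖ ^ 2 =
      (1 - q) * ‖u‖ ^ 2 + q * ‖v‖ ^ 2 - q * (1 - q) * ‖v - u‖ ^ 2 := by
  rw [norm_add_sq_real, norm_sub_sq_real, norm_smul, norm_smul, real_inner_smul_left,
    real_inner_smul_right, mul_pow, mul_pow, Real.norm_eq_abs, Real.norm_eq_abs, sq_abs, sq_abs,
    real_inner_comm u v]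
  ring

/-- Two sides of a nondegenerate triangle are linearly independent. -/
lemma eq_zero_of_smul_add_smul_eq_zero {V : Type*} [AddCommGroup V] [Module ℝ V] {A B C : V}
    (h : ¬ Collinear ℝ ({A, B, C} : Set V)) {a b : ℝ}
    (hab : a • (B - A) + b • (C - A) = 0) : a = 0 ∧ b = 0 := by
  have hb : b = 0 := by
    by_contra hb
    refine h ((collinear_iff_of_mem (p₀ := A) (by simp)).2 ⟨B - A, ?_⟩)
    rintro X (rfl | rfl | rfl)
    · exact ⟨0, by simp⟩
    · exact ⟨1, by simp⟩
    · refine ⟨-(a / b), ?_⟩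
      have hC : X - A = -(a / b) • (B - A) := by
        apply smul_right_injective V hb
        simp only [smul_smul]
        rw [show b * -(a / b) = -a by field_simp, neg_smul]
        exact eq_neg_of_add_eq_zero_right hab
      rw [← hC, vadd_eq_add, sub_add_cancel]
  subst hb
  have hBA : B - A ≠ 0 := by
    intro hBA
    rw [sub_eq_zero.1 hBA, Set.insert_eq_of_mem (by simp)] at h
    exact h (collinear_pair ℝ A C)
  simpa [hBA] using hab

/-- A point collinear with the distinct points `A` and `B` is `A + t • (B - A)` for some `t`. -/
lemma Collinear.exists_eq_add_smul {V : Type*} [AddCommGroup V] [Module ℝ V] {A B X : V}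
    (h : Collinear ℝ ({A, B, X} : Set V)) (hAB : A ≠ B) : ∃ t : ℝ, X = A + t • (B - A) := by
  obtain ⟨t, ht⟩ := mem_affineSpan_pair_iff_exists_lineMap_eq.1
    (h.mem_affineSpan_of_mem_of_ne (p₁ := A) (p₂ := B) (p₃ := X) (by simp) (by simp) (by simp) hAB)
  exact ⟨t, by rw [← ht, AffineMap.lineMap_apply_module', add_comm]⟩


/-- In the singular Miquel configuration, if `S` lies on both line `AQ` and line
`BR`, with these two lines distinct, then `S` lies on the circumcircle of
`B, P, Q`. -/
theorem singular_miquel_S_mem_circle_BPQ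
    (A B C P Q R : ℂ)
    (hABC : ¬ Collinear ℝ ({A, B, C} : Set ℂ))
    (hP : Collinear ℝ ({A, B, P} : Set ℂ)) (hPA : P ≠ A) (hPB : P ≠ B)
    -- Q is the second intersection of the circumcircle of A, P, C with line BC
    (sAPC : EuclideanGeometry.Sphere ℂ)
    (hA₁ : A ∈ sAPC) (hP₁ : P ∈ sAPC) (hC₁ : C ∈ sAPC) (hQ₁ : Q ∈ sAPC)
    (hQ : Collinear ℝ ({B, C, Q} : Set ℂ)) (hQC : Q ≠ C)
    -- R is the second intersection of the circumcircle of B, P, C with line CA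
    (sBPC : EuclideanGeometry.Sphere ℂ)
    (hB₂ : B ∈ sBPC) (hP₂ : P ∈ sBPC) (hC₂ : C ∈ sBPC) (hR₂ : R ∈ sBPC)
    (hR : Collinear ℝ ({C, A, R} : Set ℂ)) (hRC : R ≠ C)
    -- P, Q, R are distinct from all of A, B, C
    (hPC : P ≠ C) (hQA : Q ≠ A) (hQB : Q ≠ B) (hRA : R ≠ A) (hRB : R ≠ B)
    (hBPQ : ¬ Collinear ℝ ({B, P, Q} : Set ℂ))
    (S : ℂ) (hSAQ : S ∈ line[ℝ, A, Q]) (hSBR : S ∈ line[ℝ, B, R])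
    (hlines : line[ℝ, A, Q] ≠ line[ℝ, B, R])
    (s₂ : EuclideanGeometry.Sphere ℂ)
    (hs₂B : B ∈ s₂) (hs₂P : P ∈ s₂) (hs₂Q : Q ∈ s₂) :
    S ∈ s₂ := by
  have hAB : A ≠ B := by
    rintro rfl
    exact hABC (by simpa using collinear_pair ℝ A C)
  have hBC : B ≠ C := by
    rintro rfl
    exact hABC (by simpa using collinear_pair ℝ A B)
  have hCA : A ≠ C := by
    rintro rfl
    exact hABC (by simpa [Set.pair_comm] using collinear_pair ℝ A B)
  obtain ⟨p, rfl⟩ := hP.exists_eq_add_smul hAB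
  obtain ⟨q, rfl⟩ := hQ.exists_eq_add_smul hBC
  rw [Set.insert_comm] at hR
  obtain ⟨r, rfl⟩ := hR.exists_eq_add_smul hCA
  obtain ⟨s, hs⟩ := mem_affineSpan_pair_iff_exists_lineMap_eq.1 hSAQ
  obtain ⟨t, ht⟩ := mem_affineSpan_pair_iff_exists_lineMap_eq.1 hSBR
  rw [AffineMap.lineMap_apply_module', add_comm] at hs ht
  rw [EuclideanGeometry.mem_sphere] at *
  have hp : p ≠ 1 := by rintro rfl; simp at hPB
  have hp0 : p ≠ 0 := by rintro rfl; simp at hPA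
  have hq : q ≠ 1 := by rintro rfl; simp at hQC
  have hr : r ≠ 1 := by rintro rfl; simp at hRC
  have hB₂' : dist (A + (1 : ℝ) • (B - A)) sBPC.center = sBPC.radius := by simpa using hB₂
  have hC₂' : dist (A + (1 : ℝ) • (C - A)) sBPC.center = sBPC.radius := by simpa using hC₂
  have powA : p * ‖B - A‖ ^ 2 = r * ‖C - A‖ ^ 2 := by
    linear_combination power_eq_mul_of_dist_eq hr hR₂ hC₂' - power_eq_mul_of_dist_eq hp hP₂ hB₂'
  have hC₁' : dist (B + (1 : ℝ) • (C - B)) sAPC.center = sAPC.radius := by simpa using hC₁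
  have hA₁' : dist (B + (1 : ℝ) • (A - B)) sAPC.center = sAPC.radius := by simpa using hA₁
  have hP₁' : dist (B + (1 - p) • (A - B)) sAPC.center = sAPC.radius := by
    rw [← hP₁]
    congr 1
    module
  have powB : q * ‖C - B‖ ^ 2 = (1 - p) * ‖B - A‖ ^ 2 := by
    rw [norm_sub_rev B A]
    linear_combination power_eq_mul_of_dist_eq (by simpa using hp0) hP₁' hA₁'
      - power_eq_mul_of_dist_eq hq hQ₁ hC₁'
  obtain ⟨hst₁, hst₂⟩ : s * (1 - q) - (1 - t) = 0 ∧ s * q - t * r = 0 := by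
    apply eq_zero_of_smul_add_smul_eq_zero hABC
    rw [← sub_eq_zero.2 (hs.trans ht.symm)]
    module
  have stewart : ‖B + q • (C - B) - A‖ ^ 2 =
      (1 - q) * ‖B - A‖ ^ 2 + q * ‖C - A‖ ^ 2 - q * (1 - q) * ‖C - B‖ ^ 2 := by
    rw [show B + q • (C - B) - A = (1 - q) • (B - A) + q • (C - A) by module,
      norm_sq_smul_add_smul, sub_sub_sub_cancel_right]
  have hs₂B' : dist (A + (1 : ℝ) • (B - A)) s₂.center = s₂.radius := by simpa using hs₂B
  rw [← hs]
  apply dist_eq_of_power_eq (by simpa using hs₂Q)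
  rw [power_eq_mul_of_dist_eq hp hs₂P hs₂B', stewart]
  linear_combination s * (1 - q) * powB - p * ‖B - A‖ ^ 2 * hst₁ - ‖C - A‖ ^ 2 * hst₂ + t * powA
end

section
/- In the singular Miquel configuration, let S be a point lying on both line AQ and line BR, with lines AQ and BR distinct. Then S lies on the circumcircle of C, Q, R. -/
open scoped RealInnerProductSpace

section SecondIntersection

variable {V : Type*} [NormedAddCommGroup V] [InnerProductSpace ℝ V]

/-- A point of the line through `X` and `Y` has the form `X + t • (Y - X)`. -/
theorem exists_eq_add_smul_of_collinear {X Y Z : V} (hXY : X ≠ Y)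
    (h : Collinear ℝ ({X, Y, Z} : Set V)) : ∃ t : ℝ, Z = X + t • (Y - X) := by
  have hZ : Z ∈ line[ℝ, X, Y] :=
    h.mem_affineSpan_of_mem_of_ne (by simp) (by simp) (by simp) hXY
  obtain ⟨t, ht⟩ := mem_affineSpan_pair_iff_exists_lineMap_eq.1 hZ
  refine ⟨t, ?_⟩
  rw [← ht, AffineMap.lineMap_apply, vsub_eq_sub, vadd_eq_add, add_comm]

/-- Parameter of the second intersection of a sphere with the line `X + t • v`. -/
theorem EuclideanGeometry.Sphere.mul_inner_self_add_eq_zero {s : EuclideanGeometry.Sphere V}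
    {X v : V} {t : ℝ} (hX : X ∈ s) (hY : X + t • v ∈ s) (ht : t ≠ 0) :
    t * ⟪v, v⟫ + 2 * ⟪X - s.center, v⟫ = 0 := by
  rw [EuclideanGeometry.mem_sphere, dist_eq_norm] at hX hY
  have h : ‖X + t • v - s.center‖ ^ 2 = ‖X - s.center‖ ^ 2 := by rw [hX, hY]
  rw [add_sub_right_comm, norm_add_sq_real, real_inner_smul_right, norm_smul, mul_pow,
    Real.norm_eq_abs, sq_abs, ← real_inner_self_eq_norm_sq v] at h
  refine mul_left_cancel₀ ht ?_
  linear_combination h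

/-- Converse of `EuclideanGeometry.Sphere.mul_inner_self_add_eq_zero` for the parameter `1`. -/
theorem EuclideanGeometry.Sphere.add_mem_of_inner_eq_zero {s : EuclideanGeometry.Sphere V}
    {X v : V} (hX : X ∈ s) (h : ⟪v, v⟫ + 2 * ⟪X - s.center, v⟫ = 0) : X + v ∈ s := by
  rw [EuclideanGeometry.mem_sphere, dist_eq_norm] at hX ⊢
  rw [← hX, ← sq_eq_sq₀ (norm_nonneg _) (norm_nonneg _), add_sub_right_comm, norm_add_sq_real,
    ← real_inner_self_eq_norm_sq v]
  linear_combination h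

/-- Coefficients along the two sides of a nondegenerate triangle vanish if the combination does. -/
theorem eq_zero_of_smul_add_smul_eq_zero_of_not_collinear {X Y Z : V}
    (h : ¬ Collinear ℝ ({X, Y, Z} : Set V)) {k l : ℝ}
    (hkl : k • (X - Z) + l • (Y - Z) = 0) : k = 0 ∧ l = 0 := by
  have aux : ∀ {X Y : V} {k l : ℝ}, ¬ Collinear ℝ ({X, Y, Z} : Set V) →
      k • (X - Z) + l • (Y - Z) = 0 → k = 0 := by
    intro X Y k l h hkl
    by_contra hk
    refine h ((collinear_iff_of_mem (p₀ := Z) (by simp)).2 ⟨Y - Z, ?_⟩)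
    have hX : X = (-(k⁻¹ * l)) • (Y - Z) + Z := by
      rw [← sub_eq_iff_eq_add, neg_smul, mul_smul, ← smul_neg, eq_inv_smul_iff₀ hk]
      exact eq_neg_of_add_eq_zero_left hkl
    rintro p (rfl | rfl | rfl)
    · exact ⟨_, hX⟩
    · exact ⟨1, by simp⟩
    · exact ⟨0, by simp⟩
  exact ⟨aux h hkl, aux (by rwa [Set.insert_comm]) (by rwa [add_comm])⟩

end SecondIntersection


/-- In the singular Miquel configuration, if `S` lies on both line `AQ` and line
`BR`, with these two lines distinct, then `S` lies on the circumcircle of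
`C, Q, R`. -/
theorem singular_miquel_S_mem_circle_CQR
    (A B C P Q R : ℂ)
    (hABC : ¬ Collinear ℝ ({A, B, C} : Set ℂ))
    (hP : Collinear ℝ ({A, B, P} : Set ℂ)) (hPA : P ≠ A) (hPB : P ≠ B)
    -- Q is the second intersection of the circumcircle of A, P, C with line BC
    (sAPC : EuclideanGeometry.Sphere ℂ)
    (hA₁ : A ∈ sAPC) (hP₁ : P ∈ sAPC) (hC₁ : C ∈ sAPC) (hQ₁ : Q ∈ sAPC)
    (hQ : Collinear ℝ ({B, C, Q} : Set ℂ)) (hQC : Q ≠ C)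
    -- R is the second intersection of the circumcircle of B, P, C with line CA
    (sBPC : EuclideanGeometry.Sphere ℂ)
    (hB₂ : B ∈ sBPC) (hP₂ : P ∈ sBPC) (hC₂ : C ∈ sBPC) (hR₂ : R ∈ sBPC)
    (hR : Collinear ℝ ({C, A, R} : Set ℂ)) (hRC : R ≠ C)
    -- P, Q, R are distinct from all of A, B, C
    (hPC : P ≠ C) (hQA : Q ≠ A) (hQB : Q ≠ B) (hRA : R ≠ A) (hRB : R ≠ B)
    (hCQR : ¬ Collinear ℝ ({C, Q, R} : Set ℂ))
    (S : ℂ) (hSAQ : S ∈ line[ℝ, A, Q]) (hSBR : S ∈ line[ℝ, B, R])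
    (hlines : line[ℝ, A, Q] ≠ line[ℝ, B, R])
    (s₃ : EuclideanGeometry.Sphere ℂ)
    (hs₃C : C ∈ s₃) (hs₃Q : Q ∈ s₃) (hs₃R : R ∈ s₃) :
    S ∈ s₃ := by
  have hAB : A ≠ B := by
    rintro rfl
    exact hABC (by simpa using collinear_pair ℝ A C)
  have hBC : B ≠ C := by
    rintro rfl
    exact hABC (by simpa using collinear_pair ℝ A B)
  have hCA : C ≠ A := by
    rintro rfl
    exact hABC (by simpa [Set.pair_comm] using collinear_pair ℝ C B)
  obtain ⟨t, rfl⟩ := exists_eq_add_smul_of_collinear hAB hP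
  obtain ⟨q, rfl⟩ := exists_eq_add_smul_of_collinear (Z := Q) hBC.symm
    (by rwa [Set.insert_comm C B])
  obtain ⟨r, rfl⟩ := exists_eq_add_smul_of_collinear hCA hR
  have ht : t ≠ 0 := by rintro rfl; simp at hPA
  have ht' : 1 - t ≠ 0 := fun h ↦ hPB (by rw [← sub_eq_zero.1 h]; simp)
  have hq : q ≠ 0 := by rintro rfl; simp at hQC
  have hr : r ≠ 0 := by rintro rfl; simp at hRC
  obtain ⟨x, hx⟩ := mem_affineSpan_pair_iff_exists_lineMap_eq.1 hSAQ
  obtain ⟨y, hy⟩ := mem_affineSpan_pair_iff_exists_lineMap_eq.1 hSBR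
  rw [AffineMap.lineMap_apply, vsub_eq_sub, vadd_eq_add] at hx hy
  obtain ⟨a, rfl⟩ : ∃ a, A = C + a := ⟨A - C, by simp⟩
  obtain ⟨b, rfl⟩ : ∃ b, B = C + b := ⟨B - C, by simp⟩
  have hPB' : C + a + t • (C + b - (C + a)) = C + b + (1 - t) • (a - b) := by module
  rw [hPB'] at hP₂
  simp only [add_sub_cancel_left, add_sub_add_left_eq_sub] at *
  obtain ⟨hk, hl⟩ := eq_zero_of_smul_add_smul_eq_zero_of_not_collinear hABC
    (k := 1 - x - y * r) (l := x * q - (1 - y)) (by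
      simp only [add_sub_cancel_left]
      linear_combination (norm := module) hx - hy)
  have hSC : S = C + ((y * r) • a + (x * q) • b) := by
    have : y * r = 1 - x := by linarith
    rw [← hx, this]
    module
  have e₁ := sAPC.mul_inner_self_add_eq_zero hA₁ hP₁ ht
  have e₂ := sAPC.mul_inner_self_add_eq_zero hC₁ hQ₁ hq
  have e₃ := sAPC.mul_inner_self_add_eq_zero (t := 1) (v := a) hC₁ (by simpa using hA₁) one_ne_zero
  have f₁ := sBPC.mul_inner_self_add_eq_zero hB₂ hP₂ ht'
  have f₂ := sBPC.mul_inner_self_add_eq_zero hC₂ hR₂ hr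
  have f₃ := sBPC.mul_inner_self_add_eq_zero (t := 1) (v := b) hC₂ (by simpa using hB₂) one_ne_zero
  have g₁ := s₃.mul_inner_self_add_eq_zero hs₃C hs₃Q hq
  have g₂ := s₃.mul_inner_self_add_eq_zero hs₃C hs₃R hr
  rw [add_sub_right_comm] at e₁ f₁
  have hba := real_inner_comm a b
  simp only [inner_add_left, inner_sub_right _ a b, inner_sub_right _ b a, inner_sub_left a b,
    inner_sub_left b a, hba] at e₁ f₁
  have key : q * ⟪b, b⟫ + r * ⟪a, a⟫ = 2 * ⟪a, b⟫ := by
    linear_combination e₂ - e₁ - e₃ + f₂ - f₁ - f₃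
  rw [hSC]
  refine s₃.add_mem_of_inner_eq_zero hs₃C ?_
  simp only [inner_add_left, inner_add_right, real_inner_smul_left, real_inner_smul_right, hba]
  linear_combination (x * q) * g₁ + (y * r) * g₂ - (x * y * q * r) * key
    - (x * q ^ 2 * ⟪b, b⟫) * hk + (y * r ^ 2 * ⟪a, a⟫) * hl
end

section
/- In the singular Miquel configuration, let U be the circumcenter of B, C, P; let V be the circumcenter of C, A, P; let D be the circumcenter of A, R, P; let E be the circumcenter of B, P, Q; and let F be the circumcenter of C, Q, R. Then the six points U, V, D, E, F and P all lie on one common circle. -/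
/-- Equality of distances from a point of `ℂ`, in coordinates. -/
lemma Complex.dist_eq_dist_iff_coords (z w w' : ℂ) :
    dist z w = dist z w' ↔ (z.re - w.re) ^ 2 + (z.im - w.im) ^ 2
      = (z.re - w'.re) ^ 2 + (z.im - w'.im) ^ 2 := by
  rw [Complex.dist_eq_re_im, Complex.dist_eq_re_im,
    Real.sqrt_inj (by positivity) (by positivity)]

/-- The singular Miquel configuration with `P = 0`, `A = a`, `B = b` real: the common circle passes
through the origin and is centred at `k`. -/
lemma exists_dist_eq_of_singular_miquel_normalized
    {a b t s : ℝ} {c o o' U V D E F : ℂ} (ha : a ≠ 0) (hb : b ≠ 0) (hab : a ≠ b) (hc : c.im ≠ 0)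
    (ht0 : t ≠ 0) (ht1 : t ≠ 1) (hs0 : s ≠ 0) (hs1 : s ≠ 1)
    (hoA : dist o a = dist o 0) (hoC : dist o c = dist o 0)
    (hoQ : dist o (c + t * (b - c)) = dist o 0)
    (hoB' : dist o' b = dist o' 0) (hoC' : dist o' c = dist o' 0)
    (hoR' : dist o' (c + s * (a - c)) = dist o' 0)
    (hUB : dist U b = dist U 0) (hUC : dist U c = dist U 0)
    (hVA : dist V a = dist V 0) (hVC : dist V c = dist V 0)
    (hDA : dist D a = dist D 0) (hDR : dist D (c + s * (a - c)) = dist D 0)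
    (hEB : dist E b = dist E 0) (hEQ : dist E (c + t * (b - c)) = dist E 0)
    (hFQ : dist F (c + t * (b - c)) = dist F c) (hFR : dist F (c + s * (a - c)) = dist F c) :
    ∃ k : ℂ, dist k U = dist k 0 ∧ dist k V = dist k 0 ∧ dist k D = dist k 0 ∧
      dist k E = dist k 0 ∧ dist k F = dist k 0 := by
  obtain ⟨x, y⟩ := c
  obtain ⟨o₁, o₂⟩ := o
  obtain ⟨p₁, p₂⟩ := o'
  obtain ⟨u₁, u₂⟩ := U
  obtain ⟨v₁, v₂⟩ := V
  obtain ⟨d₁, d₂⟩ := D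
  obtain ⟨e₁, e₂⟩ := E
  obtain ⟨f₁, f₂⟩ := F
  simp only [Complex.dist_eq_dist_iff_coords, Complex.ofReal_re, Complex.ofReal_im, Complex.zero_re,
    Complex.zero_im, Complex.add_re, Complex.add_im, Complex.sub_re, Complex.sub_im, Complex.mul_re,
    Complex.mul_im] at *
  have ho₁ : o₁ = a / 2 := mul_left_cancel₀ ha (by linarith)
  have hp₁ : p₁ = b / 2 := mul_left_cancel₀ hb (by linarith)
  have hu₁ : u₁ = b / 2 := mul_left_cancel₀ hb (by linarith)
  have hv₁ : v₁ = a / 2 := mul_left_cancel₀ ha (by linarith)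
  have hd₁ : d₁ = a / 2 := mul_left_cancel₀ ha (by linarith)
  have he₁ : e₁ = b / 2 := mul_left_cancel₀ hb (by linarith)
  subst ho₁ hp₁ hu₁ hv₁ hd₁ he₁
  -- the power of `B` with respect to the circle `APC`, and of `A` with respect to `BPC`
  have hQ : t * ((x - b) ^ 2 + y ^ 2) = x ^ 2 + y ^ 2 - 2 * x * b + a * b :=
    mul_left_cancel₀ ht0 (by linear_combination hoQ - (1 - t) * hoC)
  have hR : s * ((x - a) ^ 2 + y ^ 2) = x ^ 2 + y ^ 2 - 2 * x * a + a * b :=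
    mul_left_cancel₀ hs0 (by linear_combination hoR' - (1 - s) * hoC')
  have hu : 2 * y * u₂ = x ^ 2 + y ^ 2 - x * b := by linear_combination -hUC
  have hv : 2 * y * v₂ = x ^ 2 + y ^ 2 - x * a := by linear_combination -hVC
  have hd : 2 * y * d₂ = a * (x - b) :=
    mul_left_cancel₀ (sub_ne_zero.mpr hs1) (by linear_combination hDR - (s - 1) * hR)
  have he : 2 * y * e₂ = b * (x - a) :=
    mul_left_cancel₀ (sub_ne_zero.mpr ht1) (by linear_combination hEQ - (t - 1) * hQ)
  have hfQ : 2 * ((f₁ - x) * (b - x) - (f₂ - y) * y) = x ^ 2 + y ^ 2 - 2 * x * b + a * b :=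
    mul_left_cancel₀ ht0 (by linear_combination -hFQ + t * hQ)
  have hfR : 2 * ((f₁ - x) * (a - x) - (f₂ - y) * y) = x ^ 2 + y ^ 2 - 2 * x * a + a * b :=
    mul_left_cancel₀ hs0 (by linear_combination -hFR + s * hR)
  have hf₁ : f₁ = 0 :=
    mul_left_cancel₀ (sub_ne_zero.mpr hab) (by linear_combination (hfR - hfQ) / 2)
  subst hf₁
  have hf : 2 * y * f₂ = x ^ 2 + y ^ 2 - a * b := by linear_combination -hfQ
  have hy : 2 * y ≠ 0 := mul_ne_zero two_ne_zero hc
  obtain rfl : u₂ = (x ^ 2 + y ^ 2 - x * b) / (2 * y) := by rw [eq_div_iff hy, ← hu]; ring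
  obtain rfl : v₂ = (x ^ 2 + y ^ 2 - x * a) / (2 * y) := by rw [eq_div_iff hy, ← hv]; ring
  obtain rfl : d₂ = a * (x - b) / (2 * y) := by rw [eq_div_iff hy, ← hd]; ring
  obtain rfl : e₂ = b * (x - a) / (2 * y) := by rw [eq_div_iff hy, ← he]; ring
  obtain rfl : f₂ = (x ^ 2 + y ^ 2 - a * b) / (2 * y) := by rw [eq_div_iff hy, ← hf]; ring
  refine ⟨⟨a / 4 - (x ^ 2 + y ^ 2 - x * a) * (x - b) / (4 * y ^ 2),
    (x ^ 2 + y ^ 2 - a * b) / (4 * y)⟩, ?_, ?_, ?_, ?_, ?_⟩ <;>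
  · dsimp only
    field_simp
    ring

/-- Three collinear points, the first two distinct: the third is an affine combination. -/
lemma Collinear.exists_eq_add_mul_sub {z w p : ℂ} (h : Collinear ℝ ({z, w, p} : Set ℂ))
    (hzw : z ≠ w) : ∃ t : ℝ, p = z + t * (w - z) := by
  obtain ⟨t, ht⟩ := mem_affineSpan_pair_iff_exists_lineMap_eq.mp
    (h.mem_affineSpan_of_mem_of_ne (p₃ := p) (by simp) (by simp) (by simp) hzw)
  refine ⟨t, ?_⟩
  rw [← ht, AffineMap.lineMap_apply]
  simp [add_comm]


/-- In the singular Miquel configuration, the circumcenters `U` of `B, C, P`;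
`V` of `C, A, P`; `D` of `A, R, P`; `E` of `B, P, Q`; `F` of `C, Q, R`,
together with `P`, all lie on one common circle. -/
theorem singular_miquel_five_centres_concyclic
    (A B C P Q R : ℂ)
    (hABC : ¬ Collinear ℝ ({A, B, C} : Set ℂ))
    (hP : Collinear ℝ ({A, B, P} : Set ℂ)) (hPA : P ≠ A) (hPB : P ≠ B)
    -- Q is the second intersection of the circumcircle of A, P, C with line BC
    (sAPC : EuclideanGeometry.Sphere ℂ)
    (hA₁ : A ∈ sAPC) (hP₁ : P ∈ sAPC) (hC₁ : C ∈ sAPC) (hQ₁ : Q ∈ sAPC)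
    (hQ : Collinear ℝ ({B, C, Q} : Set ℂ)) (hQC : Q ≠ C)
    -- R is the second intersection of the circumcircle of B, P, C with line CA
    (sBPC : EuclideanGeometry.Sphere ℂ)
    (hB₂ : B ∈ sBPC) (hP₂ : P ∈ sBPC) (hC₂ : C ∈ sBPC) (hR₂ : R ∈ sBPC)
    (hR : Collinear ℝ ({C, A, R} : Set ℂ)) (hRC : R ≠ C)
    -- P, Q, R are distinct from all of A, B, C
    (hPC : P ≠ C) (hQA : Q ≠ A) (hQB : Q ≠ B) (hRA : R ≠ A) (hRB : R ≠ B)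
    (hBCP : ¬ Collinear ℝ ({B, C, P} : Set ℂ))
    (hCAP : ¬ Collinear ℝ ({C, A, P} : Set ℂ))
    (hARP : ¬ Collinear ℝ ({A, R, P} : Set ℂ))
    (hBPQ : ¬ Collinear ℝ ({B, P, Q} : Set ℂ))
    (hCQR : ¬ Collinear ℝ ({C, Q, R} : Set ℂ))
    (U V D E F : ℂ)
    (hU : dist U B = dist U C ∧ dist U B = dist U P)
    (hV : dist V C = dist V A ∧ dist V C = dist V P)
    (hD : dist D A = dist D R ∧ dist D A = dist D P)
    (hE : dist E B = dist E P ∧ dist E B = dist E Q)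
    (hF : dist F C = dist F Q ∧ dist F C = dist F R) :
    ∃ s : EuclideanGeometry.Sphere ℂ,
      U ∈ s ∧ V ∈ s ∧ D ∈ s ∧ E ∈ s ∧ F ∈ s ∧ P ∈ s := by
  have hAB : A ≠ B := by
    rintro rfl
    exact hABC (by simpa using collinear_pair ℝ A C)
  have hBC : B ≠ C := by
    rintro rfl
    exact hABC (by simpa using collinear_pair ℝ A B)
  have hCA : C ≠ A := by
    rintro rfl
    exact hABC (by rw [Set.pair_comm, Set.insert_comm]; simpa using collinear_pair ℝ C B)
  obtain ⟨m, hm⟩ := hP.exists_eq_add_mul_sub hAB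
  obtain ⟨t, rfl⟩ := (show Collinear ℝ ({C, B, Q} : Set ℂ) by
    rwa [Set.insert_comm]).exists_eq_add_mul_sub hBC.symm
  obtain ⟨s, rfl⟩ := hR.exists_eq_add_mul_sub hCA
  set v := B - A with hv_def
  have hv : v ≠ 0 := sub_ne_zero.mpr hAB.symm
  let g : ℂ → ℂ := fun z => (z - P) / v
  have g_def (z : ℂ) : g z = (z - P) / v := rfl
  have hg (z w : ℂ) : dist (g z) (g w) = dist z w / ‖v‖ := by
    rw [g_def, g_def, dist_eq_norm, dist_eq_norm, ← sub_div, norm_div, sub_sub_sub_cancel_right]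
  have hg_eq {z w w' : ℂ} (h : dist z w = dist z w') : dist (g z) (g w) = dist (g z) (g w') := by
    rw [hg, hg, h]
  have hgA : g A = ((-m : ℝ) : ℂ) := by
    rw [g_def, div_eq_iff hv, hm]
    push_cast
    ring
  have hgB : g B = ((1 - m : ℝ) : ℂ) := by
    rw [g_def, div_eq_iff hv, hm]
    push_cast
    linear_combination -hv_def
  have hgP : g P = 0 := by simp [g_def]
  have hg_comb (r : ℝ) (z w : ℂ) : g (z + r * (w - z)) = g z + r * (g w - g z) := by
    simp only [g_def]
    ring
  have hsphere {S : EuclideanGeometry.Sphere ℂ} {z w : ℂ} (hz : z ∈ S) (hw : w ∈ S) :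
      dist S.center z = dist S.center w := by
    rw [dist_comm, EuclideanGeometry.mem_sphere.mp hz, dist_comm S.center,
      EuclideanGeometry.mem_sphere.mp hw]
  have hgC : (g C).im ≠ 0 := by
    intro h
    apply hABC
    have hC : C = P + ((g C).re : ℂ) * v := by
      have : ((g C).re : ℂ) = g C := Complex.ext rfl (by simp [h])
      rw [this, g_def, div_mul_cancel₀ _ hv]
      ring
    refine (collinear_iff_of_mem (p₀ := A) (by simp)).mpr ⟨v, ?_⟩
    rintro p (rfl | rfl | rfl)
    · exact ⟨0, by simp⟩
    · exact ⟨1, by simp [hv_def]⟩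
    · refine ⟨m + (g p).re, ?_⟩
      nth_rewrite 1 [hC]
      rw [hm]
      simp only [vadd_eq_add, Complex.real_smul]
      push_cast
      ring
  have key := exists_dist_eq_of_singular_miquel_normalized
    (a := -m) (b := 1 - m) (t := t) (s := s) (c := g C) (o := g sAPC.center) (o' := g sBPC.center)
    (U := g U) (V := g V) (D := g D) (E := g E) (F := g F)
    (by rintro h; apply hPA; rw [hm, neg_eq_zero.mp h]; simp)
    (by rintro h; apply hPB; rw [hm, ← sub_eq_zero.mp h, hv_def]; simp)
    (by intro h; linarith) hgC
    (by rintro rfl; simp at hQC) (by rintro rfl; simp at hQB)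
    (by rintro rfl; simp at hRC) (by rintro rfl; simp at hRA)
  simp only [← hgA, ← hgB, ← hgP, ← hg_comb] at key
  obtain ⟨k, hkU, hkV, hkD, hkE, hkF⟩ := key
    (hg_eq (hsphere hA₁ hP₁)) (hg_eq (hsphere hC₁ hP₁)) (hg_eq (hsphere hQ₁ hP₁))
    (hg_eq (hsphere hB₂ hP₂)) (hg_eq (hsphere hC₂ hP₂)) (hg_eq (hsphere hR₂ hP₂))
    (hg_eq hU.2) (hg_eq (hU.1.symm.trans hU.2))
    (hg_eq (hV.1.symm.trans hV.2)) (hg_eq hV.2)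
    (hg_eq hD.2) (hg_eq (hD.1.symm.trans hD.2))
    (hg_eq hE.1) (hg_eq (hE.2.symm.trans hE.1))
    (hg_eq hF.1.symm) (hg_eq hF.2.symm)
  have hk : k = g (P + k * v) := by
    rw [g_def, add_sub_cancel_left, mul_div_cancel_right₀ _ hv]
  have hback {z : ℂ} (h : dist k (g z) = dist k (g P)) :
      dist z (P + k * v) = dist P (P + k * v) := by
    rw [hk, hg, hg, div_left_inj' (norm_ne_zero_iff.mpr hv)] at h
    rwa [dist_comm, dist_comm P]
  exact ⟨⟨P + k * v, dist P (P + k * v)⟩, hback hkU, hback hkV, hback hkD, hback hkE, hback hkF,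
    rfl⟩
end

section
/- In a general Miquel configuration, let D be the circumcenter of A, R, P; let E be the circumcenter of B, P, Q; and let F be the circumcenter of C, Q, R. Then dist(D, F) · dist(A, B) = dist(D, E) · dist(A, C). -/
/-- A point of the line `XY` is an affine combination of `X` and `Y`. -/
lemma exists_eq_add_mul_sub_of_collinear {X Y Z : ℂ} (hXY : X ≠ Y)
    (h : Collinear ℝ ({X, Y, Z} : Set ℂ)) : ∃ t : ℝ, Z = X + t * (Y - X) := by
  obtain ⟨v, hv⟩ := (collinear_iff_of_mem (p₀ := X) (by simp)).1 h
  obtain ⟨s, hs⟩ := hv Y (by simp)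
  obtain ⟨r, hr⟩ := hv Z (by simp)
  have hs0 : s ≠ 0 := by
    rintro rfl
    exact hXY (by simpa using hs.symm)
  have hs0' : (s : ℂ) ≠ 0 := by exact_mod_cast hs0
  refine ⟨r / s, ?_⟩
  simp only [Complex.real_smul, vadd_eq_add] at hs hr
  rw [hs, hr]
  push_cast
  field_simp
  ring

lemma dist_eq_dist_iff_sq (O X Y : ℂ) : dist O X = dist O Y ↔
    (O.re - X.re) ^ 2 + (O.im - X.im) ^ 2 = (O.re - Y.re) ^ 2 + (O.im - Y.im) ^ 2 := by
  rw [Complex.dist_eq_re_im, Complex.dist_eq_re_im, Real.sqrt_inj (by positivity) (by positivity)]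

/-- If `O` is equidistant from `X` and a point of the line `XY` with parameter `t ≠ 0`, then
the projection of `O` to this line has parameter `t / 2`. -/
lemma two_mul_inner_eq_of_dist_eq {O X Y : ℂ} {t : ℝ} (ht : t ≠ 0)
    (h : dist O X = dist O (X + t * (Y - X))) :
    2 * ((O.re - X.re) * (Y.re - X.re) + (O.im - X.im) * (Y.im - X.im)) =
      t * ((Y.re - X.re) ^ 2 + (Y.im - X.im) ^ 2) := by
  rw [dist_eq_dist_iff_sq] at h
  simp only [Complex.add_re, Complex.add_im, Complex.mul_re, Complex.mul_im, Complex.sub_re,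
    Complex.sub_im, Complex.ofReal_re, Complex.ofReal_im] at h
  apply mul_left_cancel₀ ht
  linear_combination h

/-- For `Z` on the line `XY`, different from `X` and `Y`, the projections to this line of points
on the perpendicular bisectors of `XZ` and of `YZ`, in terms of the parameter of `Z`. -/
lemma exists_two_mul_inner_eq {X Y Z : ℂ} (hXY : X ≠ Y)
    (h : Collinear ℝ ({X, Y, Z} : Set ℂ)) (hX : Z ≠ X) (hY : Z ≠ Y) :
    ∃ t : ℝ,
      (∀ O : ℂ, dist O X = dist O Z →
        2 * ((O.re - X.re) * (Y.re - X.re) + (O.im - X.im) * (Y.im - X.im)) =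
          t * ((Y.re - X.re) ^ 2 + (Y.im - X.im) ^ 2)) ∧
      (∀ O : ℂ, dist O Y = dist O Z →
        2 * ((O.re - Y.re) * (X.re - Y.re) + (O.im - Y.im) * (X.im - Y.im)) =
          (1 - t) * ((X.re - Y.re) ^ 2 + (X.im - Y.im) ^ 2)) := by
  obtain ⟨t, rfl⟩ := exists_eq_add_mul_sub_of_collinear hXY h
  refine ⟨t, fun O hO => ?_, fun O hO => ?_⟩
  · refine two_mul_inner_eq_of_dist_eq ?_ hO
    rintro rfl
    simp at hX
  · refine two_mul_inner_eq_of_dist_eq ?_ ?_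
    · intro h0
      obtain rfl : t = 1 := by linarith
      simp at hY
    · rw [hO]
      congr 1
      push_cast
      ring

/-- The cross product of two sides of a nondegenerate triangle does not vanish. -/
lemma cross_ne_zero_of_not_collinear {X Y Z : ℂ} (h : ¬ Collinear ℝ ({X, Y, Z} : Set ℂ)) :
    (Y.re - X.re) * (Z.im - X.im) - (Y.im - X.im) * (Z.re - X.re) ≠ 0 := by
  intro h0
  apply h
  rcases eq_or_ne X Y with rfl | hXY
  · simpa using collinear_pair ℝ X Z
  have hn : (Y.re - X.re) ^ 2 + (Y.im - X.im) ^ 2 ≠ 0 := by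
    intro hn
    apply hXY
    apply Complex.ext <;> nlinarith [sq_nonneg (Y.re - X.re), sq_nonneg (Y.im - X.im)]
  refine (collinear_iff_of_mem (p₀ := X) (by simp)).2 ⟨Y - X, ?_⟩
  rintro p (rfl | rfl | rfl)
  · exact ⟨0, by simp⟩
  · exact ⟨1, by simp⟩
  · refine ⟨((Y.re - X.re) * (p.re - X.re) + (Y.im - X.im) * (p.im - X.im)) /
      ((Y.re - X.re) ^ 2 + (Y.im - X.im) ^ 2), ?_⟩
    apply Complex.ext
    · simp only [vadd_eq_add, Complex.add_re, Complex.smul_re, Complex.sub_re, smul_eq_mul]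
      field_simp
      linear_combination -(Y.im - X.im) * h0
    · simp only [vadd_eq_add, Complex.add_im, Complex.smul_im, Complex.sub_im, smul_eq_mul]
      field_simp
      linear_combination (Y.re - X.re) * h0

/-- Cramer's rule for two equations in two unknowns. -/
lemma cramer_two {x₁ x₂ u₁ u₂ w₁ w₂ α β : ℝ} (hu : 2 * (x₁ * u₁ + x₂ * u₂) = α)
    (hw : 2 * (x₁ * w₁ + x₂ * w₂) = β) :
    2 * (u₁ * w₂ - u₂ * w₁) * x₁ = α * w₂ - β * u₂ ∧
      2 * (u₁ * w₂ - u₂ * w₁) * x₂ = β * u₁ - α * w₁ := by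
  subst hu hw
  constructor <;> ring

/-- In a general Miquel configuration, with `D`, `E`, `F` the circumcenters of
`A, R, P`; `B, P, Q`; `C, Q, R` respectively,
`dist D F * dist A B = dist D E * dist A C`. -/
theorem miquel_centres_ratio_DF_DE
    (A B C P Q R : ℂ)
    (hABC : ¬ Collinear ℝ ({A, B, C} : Set ℂ))
    (hP : Collinear ℝ ({A, B, P} : Set ℂ))
    (hQ : Collinear ℝ ({B, C, Q} : Set ℂ))
    (hR : Collinear ℝ ({C, A, R} : Set ℂ))
    (hPA : P ≠ A) (hPB : P ≠ B) (hPC : P ≠ C)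
    (hQA : Q ≠ A) (hQB : Q ≠ B) (hQC : Q ≠ C)
    (hRA : R ≠ A) (hRB : R ≠ B) (hRC : R ≠ C)
    (hARP : ¬ Collinear ℝ ({A, R, P} : Set ℂ))
    (hBPQ : ¬ Collinear ℝ ({B, P, Q} : Set ℂ))
    (hCQR : ¬ Collinear ℝ ({C, Q, R} : Set ℂ))
    (D E F : ℂ)
    (hD : dist D A = dist D R ∧ dist D A = dist D P)
    (hE : dist E B = dist E P ∧ dist E B = dist E Q)
    (hF : dist F C = dist F Q ∧ dist F C = dist F R) :
    dist D F * dist A B = dist D E * dist A C := by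
  have hc := cross_ne_zero_of_not_collinear hABC
  have hAB : A ≠ B := by
    rintro rfl
    simp at hc
  have hCA : C ≠ A := by
    rintro rfl
    simp at hc
  have hBC : B ≠ C := by
    rintro rfl
    exact hc (by ring)
  obtain ⟨p, hpA, hpB⟩ := exists_two_mul_inner_eq hAB hP hPA hPB
  obtain ⟨q, hqB, hqC⟩ := exists_two_mul_inner_eq hBC hQ hQB hQC
  obtain ⟨r, hrC, hrA⟩ := exists_two_mul_inner_eq hCA hR hRC hRA
  have hd₁ := hpA D hD.2
  have hd₂ := hrA D hD.1
  have he₁ := hpB E hE.1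
  have he₂ := hqB E hE.2
  have hf₁ := hqC F hF.1
  have hf₂ := hrC F hF.2
  -- The triangles `DEF` and `ABC` are directly similar.
  have key : (D - F) * (A - B) = (D - E) * (A - C) := by
    obtain ⟨a₁, a₂⟩ := A
    obtain ⟨b₁, b₂⟩ := B
    obtain ⟨c₁, c₂⟩ := C
    obtain ⟨d₁, d₂⟩ := D
    obtain ⟨e₁, e₂⟩ := E
    obtain ⟨f₁, f₂⟩ := F
    simp only at hc hd₁ hd₂ he₁ he₂ hf₁ hf₂
    have hxu : 2 * ((e₁ - d₁) * (b₁ - a₁) + (e₂ - d₂) * (b₂ - a₂)) =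
        (b₁ - a₁) ^ 2 + (b₂ - a₂) ^ 2 := by
      linear_combination -he₁ - hd₁
    have hyv : 2 * ((f₁ - d₁) * (c₁ - a₁) + (f₂ - d₂) * (c₂ - a₂)) =
        (c₁ - a₁) ^ 2 + (c₂ - a₂) ^ 2 := by
      linear_combination -hf₂ - hd₂
    have hxw : 2 * ((e₁ - d₁) * (c₁ - b₁) + (e₂ - d₂) * (c₂ - b₂)) =
        2 * ((b₁ - a₁) * (c₁ - b₁) + (b₂ - a₂) * (c₂ - b₂)) +
        q * ((c₁ - b₁) ^ 2 + (c₂ - b₂) ^ 2) - (1 - r) * ((c₁ - a₁) ^ 2 + (c₂ - a₂) ^ 2)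
          + p * ((b₁ - a₁) ^ 2 + (b₂ - a₂) ^ 2) := by
      linear_combination he₂ - hd₂ + hd₁
    have hyw : 2 * ((f₁ - d₁) * (c₁ - b₁) + (f₂ - d₂) * (c₂ - b₂)) =
        2 * ((c₁ - a₁) * (c₁ - b₁) + (c₂ - a₂) * (c₂ - b₂)) -
        (1 - q) * ((c₁ - b₁) ^ 2 + (c₂ - b₂) ^ 2) - (1 - r) * ((c₁ - a₁) ^ 2 + (c₂ - a₂) ^ 2)
          + p * ((b₁ - a₁) ^ 2 + (b₂ - a₂) ^ 2) := by
      linear_combination -hf₁ - hd₂ + hd₁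
    obtain ⟨hX₁, hX₂⟩ := cramer_two hxu hxw
    obtain ⟨hY₁, hY₂⟩ := cramer_two hyv hyw
    have hc2 := mul_ne_zero (two_ne_zero (α := ℝ)) hc
    apply Complex.ext
    · simp only [Complex.mul_re, Complex.sub_re, Complex.sub_im]
      apply mul_left_cancel₀ hc2
      linear_combination (b₁ - a₁) * hY₁ - (b₂ - a₂) * hY₂ - (c₁ - a₁) * hX₁ + (c₂ - a₂) * hX₂
    · simp only [Complex.mul_im, Complex.sub_re, Complex.sub_im]
      apply mul_left_cancel₀ hc2
      linear_combination (b₁ - a₁) * hY₂ + (b₂ - a₂) * hY₁ - (c₁ - a₁) * hX₂ - (c₂ - a₂) * hX₁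
  simp only [Complex.dist_eq, ← norm_mul, key]
end

section
/- In a general Miquel configuration, let D be the circumcenter of A, R, P; let E be the circumcenter of B, P, Q; and let F be the circumcenter of C, Q, R. Then triangle DEF is directly similar to triangle ABC: there exist complex numbers a and b with a ≠ 0 such that D = a·A + b, E = a·B + b, and F = a·C + b. -/
/-- If `Z` lies on the line `XY`, the centre of a circle through `X, Z` and the centre of a circle
through `Y, Z` have projections to the line `XY` that differ by half of `Y - X`. -/
theorem re_center_sub_center_div {X Y Z D E : ℂ} (hXY : X ≠ Y)
    (hZ : Collinear ℝ ({X, Y, Z} : Set ℂ)) (hZX : Z ≠ X) (hZY : Z ≠ Y)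
    (hD : dist D X = dist D Z) (hE : dist E Y = dist E Z) :
    ((E - D) / (Y - X)).re = 1 / 2 := by
  obtain ⟨v, hv⟩ := (collinear_iff_of_mem (p₀ := X) (by simp)).1 hZ
  obtain ⟨s, rfl⟩ := hv Y (by simp)
  obtain ⟨t, rfl⟩ := hv Z (by simp)
  simp only [vadd_eq_add, Complex.real_smul] at *
  have hs : s ≠ 0 := by rintro rfl; simp at hXY
  have hv0 : v ≠ 0 := by rintro rfl; simp at hXY
  have ht : t ≠ 0 := by rintro rfl; simp at hZX
  have hts : t - s ≠ 0 := by
    intro h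
    rw [sub_eq_zero.1 h] at hZY
    exact hZY rfl
  have hn : Complex.normSq v ≠ 0 := by simpa using hv0
  rw [Complex.dist_eq, Complex.dist_eq, ← sq_eq_sq₀ (norm_nonneg _) (norm_nonneg _),
    Complex.sq_norm, Complex.sq_norm, Complex.normSq_apply, Complex.normSq_apply] at hD hE
  rw [add_sub_cancel_right, Complex.div_re]
  simp only [Complex.normSq_mul, Complex.normSq_ofReal]
  simp only [Complex.normSq_apply, Complex.add_re, Complex.add_im, Complex.sub_re, Complex.sub_im,
    Complex.mul_re, Complex.mul_im, Complex.ofReal_re, Complex.ofReal_im] at *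
  have h₁ : 2 * ((D.re - X.re) * v.re + (D.im - X.im) * v.im)
      = t * (v.re * v.re + v.im * v.im) := by
    apply mul_left_cancel₀ ht
    linear_combination hD
  have h₂ : 2 * ((E.re - X.re) * v.re + (E.im - X.im) * v.im)
      = (s + t) * (v.re * v.re + v.im * v.im) := by
    apply mul_left_cancel₀ hts
    linear_combination hE
  rw [← add_div, div_eq_iff (mul_ne_zero (mul_ne_zero hs hs) hn)]
  linear_combination s / 2 * (h₂ - h₁)

/-- Three points of the plane are collinear when the ratio of two sides is real. -/
theorem collinear_of_div_im_eq_zero {A B C : ℂ} (hBC : B ≠ C)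
    (h : ((C - A) / (C - B)).im = 0) : Collinear ℝ ({A, B, C} : Set ℂ) := by
  have hne : C - B ≠ 0 := sub_ne_zero.2 hBC.symm
  obtain ⟨t, ht⟩ : ∃ t : ℝ, (C - A) / (C - B) = t :=
    ⟨_, Complex.ext rfl (by simpa using h)⟩
  rw [div_eq_iff hne] at ht
  refine (collinear_iff_of_mem (p₀ := C) (by simp)).2 ⟨C - B, ?_⟩
  simp only [Set.mem_insert_iff, Set.mem_singleton_iff, forall_eq_or_imp, forall_eq,
    vadd_eq_add, Complex.real_smul]
  refine ⟨⟨-t, ?_⟩, ⟨-1, ?_⟩, ⟨0, ?_⟩⟩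
  · push_cast
    linear_combination -ht
  · push_cast
    ring
  · simp


/-- In a general Miquel configuration, the triangle `DEF` of circumcenters of
`A, R, P`; `B, P, Q`; `C, Q, R` is directly similar to triangle `ABC`:
there are complex numbers `a ≠ 0` and `b` with `D = a·A + b`, `E = a·B + b`
and `F = a·C + b`. -/
theorem miquel_centres_directly_similar
    (A B C P Q R : ℂ)
    (hABC : ¬ Collinear ℝ ({A, B, C} : Set ℂ))
    (hP : Collinear ℝ ({A, B, P} : Set ℂ))
    (hQ : Collinear ℝ ({B, C, Q} : Set ℂ))
    (hR : Collinear ℝ ({C, A, R} : Set ℂ))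
    (hPA : P ≠ A) (hPB : P ≠ B) (hPC : P ≠ C)
    (hQA : Q ≠ A) (hQB : Q ≠ B) (hQC : Q ≠ C)
    (hRA : R ≠ A) (hRB : R ≠ B) (hRC : R ≠ C)
    (hARP : ¬ Collinear ℝ ({A, R, P} : Set ℂ))
    (hBPQ : ¬ Collinear ℝ ({B, P, Q} : Set ℂ))
    (hCQR : ¬ Collinear ℝ ({C, Q, R} : Set ℂ))
    (D E F : ℂ)
    (hD : dist D A = dist D R ∧ dist D A = dist D P)
    (hE : dist E B = dist E P ∧ dist E B = dist E Q)
    (hF : dist F C = dist F Q ∧ dist F C = dist F R) :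
    ∃ a b : ℂ, a ≠ 0 ∧ D = a * A + b ∧ E = a * B + b ∧ F = a * C + b := by
  have hAB : A ≠ B := by rintro rfl; exact hABC (by simp [collinear_pair])
  have hBC : B ≠ C := by rintro rfl; exact hABC (by simp [collinear_pair])
  have hAC : A ≠ C := by
    rintro rfl
    rw [Set.pair_comm, Set.insert_eq_of_mem (by simp)] at hABC
    exact hABC (collinear_pair ℝ A B)
  have hu : B - A ≠ 0 := sub_ne_zero.2 hAB.symm
  have hv : C - A ≠ 0 := sub_ne_zero.2 hAC.symm
  have hw : C - B ≠ 0 := sub_ne_zero.2 hBC.symm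
  have h₁ := re_center_sub_center_div hAB hP hPA hPB hD.2 hE.1
  have h₂ := re_center_sub_center_div hBC hQ hQB hQC hE.2 hF.1
  have h₃ : ((F - D) / (C - A)).re = 1 / 2 := by
    rw [← neg_div_neg_eq, neg_sub, neg_sub]
    exact re_center_sub_center_div hAC.symm hR hRC hRA hF.2 hD.1
  obtain ⟨a, ha⟩ : ∃ a, a = (E - D) / (B - A) := ⟨_, rfl⟩
  obtain ⟨c, hc⟩ : ∃ c, c = (F - D) / (C - A) := ⟨_, rfl⟩
  rw [← ha] at h₁
  rw [← hc] at h₃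
  have haE := (eq_div_iff hu).1 ha
  have hcF := (eq_div_iff hv).1 hc
  have key : (F - E) / (C - B) = a + (c - a) * ((C - A) / (C - B)) := by
    field_simp
    linear_combination haE - hcF
  have him : (c - a).im * ((C - A) / (C - B)).im = 0 := by
    rw [key, Complex.add_re, Complex.mul_re, Complex.sub_re, h₁, h₃] at h₂
    linear_combination -h₂
  have hca : c = a := by
    rcases mul_eq_zero.1 him with h | h
    · exact Complex.ext (h₃.trans h₁.symm) (sub_eq_zero.1 h)
    · exact absurd (collinear_of_div_im_eq_zero hBC h) hABC
  refine ⟨a, D - a * A, ?_, by ring, by linear_combination -haE, ?_⟩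
  · rintro rfl
    norm_num at h₁
  · linear_combination -hcF + (C - A) * hca
end

section
/- In a general Miquel configuration, let D be the circumcenter of A, R, P; let E be the circumcenter of B, P, Q; let F be the circumcenter of C, Q, R; and let S be a common point of the circumcircles of A, R, P; of B, P, Q; and of C, Q, R. If a, b are complex numbers with a ≠ 0 and a ≠ 1 such that D = a·A + b, E = a·B + b, and F = a·C + b, then the unique fixed point of the direct similarity z ↦ a·z + b is S; that is, a·S + b = S. -/
open Complex in
/-- Equality of distances in `ℂ`, in real coordinates. -/
theorem sq_dist_coords_of_dist_eq {x y z : ℂ} (h : dist x y = dist x z) :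
    (x.re - y.re) ^ 2 + (x.im - y.im) ^ 2 = (x.re - z.re) ^ 2 + (x.im - z.im) ^ 2 := by
  rwa [dist_eq_re_im, dist_eq_re_im, Real.sqrt_inj (by positivity) (by positivity)] at h

/-- A vector orthogonal to a nonzero `w : ℂ` is a real multiple of `I * w`. -/
theorem exists_eq_real_smul_I_mul_of_orthogonal {x w : ℂ} (hw : w ≠ 0)
    (h : x.re * w.re + x.im * w.im = 0) : ∃ r : ℝ, x = r • (Complex.I * w) := by
  have hn : w.re ^ 2 + w.im ^ 2 ≠ 0 := by
    intro h0
    exact hw (Complex.ext (by simp; nlinarith [sq_nonneg w.re, sq_nonneg w.im])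
      (by simp; nlinarith [sq_nonneg w.re, sq_nonneg w.im]))
  obtain ⟨r, hr⟩ : ∃ r : ℝ, r * (w.re ^ 2 + w.im ^ 2) = x.im * w.re - x.re * w.im :=
    ⟨_, div_mul_cancel₀ _ hn⟩
  refine ⟨r, Complex.ext ?_ ?_⟩ <;> apply mul_right_cancel₀ hn <;> simp [-mul_eq_mul_right_iff]
  · linear_combination w.re * h + w.im * hr
  · linear_combination w.im * h - w.re * hr

/-- Three points whose differences with a fixed point `S` are orthogonal to a nonzero vector
are collinear. -/
theorem collinear_of_orthogonal {A B C S w : ℂ} (hw : w ≠ 0)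
    (hA : (A - S).re * w.re + (A - S).im * w.im = 0)
    (hB : (B - S).re * w.re + (B - S).im * w.im = 0)
    (hC : (C - S).re * w.re + (C - S).im * w.im = 0) :
    Collinear ℝ ({A, B, C} : Set ℂ) := by
  rw [collinear_iff_exists_forall_eq_smul_vadd]
  refine ⟨S, Complex.I * w, ?_⟩
  rintro p (rfl | rfl | rfl)
  · obtain ⟨r, hr⟩ := exists_eq_real_smul_I_mul_of_orthogonal hw hA
    exact ⟨r, by rw [← hr]; simp⟩
  · obtain ⟨r, hr⟩ := exists_eq_real_smul_I_mul_of_orthogonal hw hB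
    exact ⟨r, by rw [← hr]; simp⟩
  · obtain ⟨r, hr⟩ := exists_eq_real_smul_I_mul_of_orthogonal hw hC
    exact ⟨r, by rw [← hr]; simp⟩

/-- If the line `AB` meets again, at a common point `P`, the circles through `A` and `B` centred at
the images of `A` and `B` under `z ↦ a * z + b`, then `a` has real part `1 / 2`. -/
theorem two_mul_re_eq_one_of_second_intersection {A B P a b : ℂ} (hAB : A ≠ B)
    (hP : Collinear ℝ ({A, B, P} : Set ℂ)) (hPA : P ≠ A) (hPB : P ≠ B)
    (hD : dist (a * A + b) A = dist (a * A + b) P)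
    (hE : dist (a * B + b) B = dist (a * B + b) P) : 2 * a.re = 1 := by
  rw [collinear_iff_of_mem (p₀ := A) (by simp)] at hP
  obtain ⟨v, hv⟩ := hP
  obtain ⟨s, hs⟩ := hv B (by simp)
  obtain ⟨u, hu⟩ := hv P (by simp)
  have hs0 : s ≠ 0 := by rintro rfl; exact hAB (by simpa using hs.symm)
  have hv0 : v ≠ 0 := by rintro rfl; exact hAB (by simpa using hs.symm)
  have hu0 : u ≠ 0 := by rintro rfl; exact hPA (by simpa using hu)
  have hus : u - s ≠ 0 := by
    intro h
    exact hPB (by rw [hu, hs, sub_eq_zero.mp h])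
  have hn : v.re ^ 2 + v.im ^ 2 ≠ 0 := by
    intro h0
    exact hv0 (Complex.ext (by simp; nlinarith [sq_nonneg v.re, sq_nonneg v.im])
      (by simp; nlinarith [sq_nonneg v.re, sq_nonneg v.im]))
  have h1 := sq_dist_coords_of_dist_eq hD
  have h2 := sq_dist_coords_of_dist_eq hE
  subst hs hu
  simp at h1 h2
  generalize v.re = v₁ at *
  generalize v.im = v₂ at *
  generalize A.re = x at *
  generalize A.im = y at *
  generalize a.re = p at *
  generalize a.im = q at *
  generalize b.re = b₁ at *
  generalize b.im = b₂ at *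
  have h3 : u * (v₁ ^ 2 + v₂ ^ 2) =
      2 * ((p * x - q * y + b₁ - x) * v₁ + (p * y + q * x + b₂ - y) * v₂) := by
    apply mul_left_cancel₀ hu0
    linear_combination -h1
  have h4 : (u - s) * (v₁ ^ 2 + v₂ ^ 2) =
      2 * ((p * (s * v₁ + x) - q * (s * v₂ + y) + b₁ - (s * v₁ + x)) * v₁
        + (p * (s * v₂ + y) + q * (s * v₁ + x) + b₂ - (s * v₂ + y)) * v₂) := by
    apply mul_left_cancel₀ hus
    linear_combination -h2
  apply mul_left_cancel₀ (mul_ne_zero hs0 hn)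
  linear_combination h3 - h4

/-- If `2 * a.re = 1` and the image of `X` under `z ↦ a * z + b` is equidistant from `S` and `X`,
then `X - S` is orthogonal to the displacement of `S`. -/
theorem orthogonal_displacement_of_dist_eq {a b S X : ℂ} (ha : 2 * a.re = 1)
    (h : dist (a * X + b) S = dist (a * X + b) X) :
    (X - S).re * (a * S + b - S).re + (X - S).im * (a * S + b - S).im = 0 := by
  have h1 := sq_dist_coords_of_dist_eq h
  simp at h1 ⊢
  linear_combination h1 / 2 - ((X.re - S.re) ^ 2 + (X.im - S.im) ^ 2) / 2 * ha

/-- In a general Miquel configuration, let `S` be a common point of the three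
Miquel circles (with centres `D`, `E`, `F`).  If `a ≠ 0, 1` and `b` realise the
direct similarity `D = a·A + b`, `E = a·B + b`, `F = a·C + b`, then the unique
fixed point of `z ↦ a·z + b` is `S`, i.e. `a·S + b = S`. -/
theorem miquel_similarity_fixed_point
    (A B C P Q R : ℂ)
    (hABC : ¬ Collinear ℝ ({A, B, C} : Set ℂ))
    (hP : Collinear ℝ ({A, B, P} : Set ℂ))
    (hQ : Collinear ℝ ({B, C, Q} : Set ℂ))
    (hR : Collinear ℝ ({C, A, R} : Set ℂ))
    (hPA : P ≠ A) (hPB : P ≠ B) (hPC : P ≠ C)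
    (hQA : Q ≠ A) (hQB : Q ≠ B) (hQC : Q ≠ C)
    (hRA : R ≠ A) (hRB : R ≠ B) (hRC : R ≠ C)
    (hARP : ¬ Collinear ℝ ({A, R, P} : Set ℂ))
    (hBPQ : ¬ Collinear ℝ ({B, P, Q} : Set ℂ))
    (hCQR : ¬ Collinear ℝ ({C, Q, R} : Set ℂ))
    (D E F : ℂ)
    (hD : dist D A = dist D R ∧ dist D A = dist D P)
    (hE : dist E B = dist E P ∧ dist E B = dist E Q)
    (hF : dist F C = dist F Q ∧ dist F C = dist F R)
    (S : ℂ)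
    (hSD : dist D S = dist D A) (hSE : dist E S = dist E B)
    (hSF : dist F S = dist F C)
    (a b : ℂ) (ha : a ≠ 0) (ha1 : a ≠ 1)
    (hDa : D = a * A + b) (hEa : E = a * B + b) (hFa : F = a * C + b) :
    a * S + b = S := by
  subst hDa hEa hFa
  have hAB : A ≠ B := by
    rintro rfl
    exact hABC (by simpa using collinear_pair ℝ A C)
  have hre := two_mul_re_eq_one_of_second_intersection hAB hP hPA hPB hD.2 hE.1
  by_contra h
  exact hABC (collinear_of_orthogonal (sub_ne_zero.mpr h)
    (orthogonal_displacement_of_dist_eq hre hSD)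
    (orthogonal_displacement_of_dist_eq hre hSE)
    (orthogonal_displacement_of_dist_eq hre hSF))
end
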